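/- arXiv:0804.3920 — 5 statements merged into one kernel-verified Lean document; each statement's English description precedes it below -/
import Mathlib

section
/- Let a > 0, let V : ℝ → ℝ be real-analytic, and let λ be a Dirichlet eigenvalue of L = −d²/dx² − V on [0,a]. Suppose the set of Dirichlet eigenvalues strictly smaller than λ is finite with exactly m elements (so that λ is the (m+1)-st Dirichlet eigenvalue). Then every Dirichlet eigenfunction for λ has exactly m + 2 zeros in the closed interval [0,a]. -/
/-- `f` is a Dirichlet eigenfunction on `[0,a]` of `L = -d²/dx² - V` with eigenvalue `lam`. -/
def IsDirichletEigenfunction (a : ℝ) (V : ℝ → ℝ) (lam : ℝ) (f : ℝ → ℝ) : Prop :=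
  ContDiff ℝ (⊤ : ℕ∞) f ∧ f ≠ 0 ∧
    (∀ x : ℝ, deriv (deriv f) x + (V x + lam) * f x = 0) ∧ f 0 = 0 ∧ f a = 0

open Set Filter Topology Real
open scoped NNReal

/-- A vector field that is Lipschitz in space and bounded, uniformly on compact time intervals,
has a global integral curve through every point. -/
lemma exists_forall_hasDerivAt_of_lipschitz_of_bounded {E : Type*} [NormedAddCommGroup E]
    [NormedSpace ℝ E] [CompleteSpace E] {v : ℝ → E → E} (hv : ∀ x, Continuous fun t => v t x)
    (hb : ∀ T : ℝ, ∃ K L : ℝ≥0, ∀ t ∈ Icc (-T) T, LipschitzWith K (v t) ∧ ∀ x, ‖v t x‖ ≤ L)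
    (x₀ : E) : ∃ γ : ℝ → E, γ 0 = x₀ ∧ ∀ t, HasDerivAt γ (v t (γ t)) t := by
  have hloc : ∀ n : ℕ, ∃ γ : ℝ → E, γ 0 = x₀ ∧
      ∀ t ∈ Ioo (-((n : ℝ) + 1)) (n + 1), HasDerivAt γ (v t (γ t)) t := by
    intro n
    have hn : (0 : ℝ) ≤ n + 1 := by positivity
    obtain ⟨K, L, hKL⟩ := hb (n + 1)
    have hpl : IsPicardLindelof v (⟨0, neg_nonpos.2 hn, hn⟩ : Icc (-((n : ℝ) + 1)) (n + 1)) x₀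
        (L * (n + 1)) 0 L K :=
      { lipschitzOnWith := fun t ht => (hKL t ht).1.lipschitzOnWith
        continuousOn := fun x _ => (hv x).continuousOn
        norm_le := fun t ht x _ => (hKL t ht).2 x
        mul_max_le := by simp }
    obtain ⟨γ, h0, hγ⟩ := hpl.exists_eq_forall_mem_Icc_hasDerivWithinAt₀
    exact ⟨γ, h0, fun t ht => (hγ t (Ioo_subset_Icc_self ht)).hasDerivAt (Icc_mem_nhds ht.1 ht.2)⟩
  choose γ h0 hγ using hloc
  have agree_of_le : ∀ m n : ℕ, m ≤ n → ∀ s : ℝ, |s| < m + 1 → γ m s = γ n s := by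
    intro m n hmn s hs
    obtain ⟨K, L, hKL⟩ := hb (m + 1)
    have hmn' : (m : ℝ) ≤ n := by exact_mod_cast hmn
    have hm : (0 : ℝ) < m + 1 := by positivity
    exact ODE_solution_unique_of_mem_Ioo (K := K) (s := fun _ => univ) (t₀ := 0)
      (fun t ht => (hKL t (Ioo_subset_Icc_self ht)).1.lipschitzOnWith)
      ⟨by linarith, hm⟩ (fun t ht => ⟨hγ m t ht, mem_univ _⟩)
      (fun t ht => ⟨hγ n t ⟨by linarith [ht.1], by linarith [ht.2]⟩, mem_univ _⟩)
      (by rw [h0, h0]) (abs_lt.mp hs)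
  have agree : ∀ (m n : ℕ) (s : ℝ), |s| < m + 1 → |s| < n + 1 → γ m s = γ n s := by
    intro m n s hm hn
    rcases le_total m n with h | h
    · exact agree_of_le m n h s hm
    · exact (agree_of_le n m h s hn).symm
  have hceil : ∀ s : ℝ, |s| < (⌈|s|⌉₊ : ℝ) + 1 := fun s => by linarith [Nat.le_ceil |s|]
  refine ⟨fun t => γ ⌈|t|⌉₊ t, h0 _, fun t => ?_⟩
  refine (hγ ⌈|t|⌉₊ t (abs_lt.mp (hceil t))).congr_of_eventuallyEq ?_
  filter_upwards [(continuous_abs.isOpen_preimage _ isOpen_Iio).mem_nhds (hceil t)] with s hs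
  exact agree _ _ s (hceil s) hs

/-- `θ` solves the Prüfer phase equation `θ' = cos² θ + q sin² θ` of `y'' + q y = 0`. -/
def IsPruferPhase (q θ : ℝ → ℝ) : Prop :=
  ∀ x, HasDerivAt θ (1 + (q x - 1) * sin (θ x) ^ 2) x

lemma sin_sq_sub_sin_sq_eq (x y : ℝ) :
    sin x ^ 2 - sin y ^ 2 = sin (x + y) * sinc (x - y) * (x - y) := by
  have h : sinc (x - y) * (x - y) = sin (x - y) := by
    rcases eq_or_ne (x - y) 0 with h | h
    · simp [h]
    · rw [sinc_of_ne_zero h, div_mul_cancel₀ _ h]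
  rw [mul_assoc, h, sin_add, sin_sub]
  linear_combination sin y ^ 2 * sin_sq_add_cos_sq x - sin x ^ 2 * sin_sq_add_cos_sq y

lemma abs_sin_mul_sinc_le_one (x y : ℝ) : |sin x * sinc y| ≤ 1 := by
  rw [abs_mul]
  exact mul_le_one₀ (abs_sin_le_one _) (abs_nonneg _) (abs_sinc_le_one _)

lemma exists_isPruferPhase {q : ℝ → ℝ} (hq : Continuous q) (θ₀ : ℝ) :
    ∃ θ, θ 0 = θ₀ ∧ IsPruferPhase q θ := by
  refine exists_forall_hasDerivAt_of_lipschitz_of_bounded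
    (v := fun t θ => 1 + (q t - 1) * sin θ ^ 2) (fun x => by fun_prop) (fun T => ?_) θ₀
  obtain ⟨C, hC⟩ := isCompact_Icc.exists_bound_of_continuousOn
    (s := Icc (-T) T) (f := fun t => q t - 1) (by fun_prop)
  refine ⟨C.toNNReal, 1 + C.toNNReal, fun t ht => ⟨LipschitzWith.of_dist_le_mul fun x y => ?_,
    fun x => ?_⟩⟩
  · have hCt : |q t - 1| ≤ C.toNNReal := (hC t ht).trans (le_coe_toNNReal C)
    rw [Real.dist_eq, Real.dist_eq, show 1 + (q t - 1) * sin x ^ 2 - (1 + (q t - 1) * sin y ^ 2)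
      = (q t - 1) * (sin x ^ 2 - sin y ^ 2) by ring, sin_sq_sub_sin_sq_eq, abs_mul, abs_mul]
    have := mul_le_mul_of_nonneg_right (abs_sin_mul_sinc_le_one (x + y) (x - y)) (abs_nonneg (x - y))
    exact mul_le_mul hCt (by linarith) (by positivity) (by positivity)
  · have hCt : |q t - 1| ≤ C.toNNReal := (hC t ht).trans (le_coe_toNNReal C)
    refine (norm_add_le _ _).trans ?_
    push_cast
    rw [norm_one, Real.norm_eq_abs, abs_mul, abs_of_nonneg (sq_nonneg (sin x))]
    have := sin_sq_le_one x
    have := mul_le_mul hCt this (by positivity) (by positivity)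
    linarith

namespace IsPruferPhase

variable {q θ θ' : ℝ → ℝ} {x y a : ℝ}

lemma continuous (h : IsPruferPhase q θ) : Continuous θ :=
  continuous_iff_continuousAt.2 fun x => (h x).continuousAt

/-- The phase crosses integer multiples of `π` only upwards. -/
lemma int_mul_pi_lt (h : IsPruferPhase q θ) (k : ℤ) (hxy : x < y) (hx : k * π ≤ θ x) :
    k * π < θ y := by
  have hder : ∀ z, k * π = θ z → HasDerivAt θ 1 z := fun z hz => by
    simpa [← hz, sin_int_mul_pi] using h z
  have hle : ∀ ⦃z⦄, z ∈ Icc x y → k * π ≤ θ z :=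
    image_le_of_deriv_right_lt_deriv_boundary (f := fun _ => k * π) (f' := fun _ => 0)
      continuousOn_const (fun _ _ => hasDerivWithinAt_const ..) hx h fun z _ hz => by
        simp [← hz, sin_int_mul_pi]
  refine (hle ⟨hxy.le, le_rfl⟩).lt_of_ne fun hy => ?_
  have hs := (hasDerivAt_iff_tendsto_slope.1 (hder y hy)).mono_left
    (nhdsWithin_mono y (s := Iio y) fun z hz => ne_of_lt hz)
  obtain ⟨z, hz, hzxy⟩ := ((hs.eventually (lt_mem_nhds one_pos)).and
    (Ioo_mem_nhdsLT hxy)).exists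
  have h1 := hle (Ioo_subset_Icc_self hzxy)
  rw [slope_def_field] at hz
  exact hz.not_ge (div_nonpos_of_nonneg_of_nonpos (by linarith) (by linarith [hzxy.2]))

lemma pos (h : IsPruferPhase q θ) (h0 : θ 0 = 0) (hx : 0 < x) : 0 < θ x := by
  simpa using h.int_mul_pi_lt 0 hx (by simp [h0])

lemma le_pi_div_two (h : IsPruferPhase q θ) (h0 : θ 0 = 0) (ha : 0 ≤ a)
    (hq : ∀ x ∈ Icc 0 a, q x < 0) : θ a ≤ π / 2 := by
  refine image_le_of_deriv_right_lt_deriv_boundary (a := 0) (b := a) (B := fun _ => π / 2)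
    (B' := fun _ => 0) h.continuous.continuousOn (fun x _ => (h x).hasDerivWithinAt)
    (by rw [h0]; positivity) (fun _ => hasDerivAt_const ..) (fun x hx hθ => ?_) ⟨ha, le_rfl⟩
  simpa [hθ] using hq x (Ico_subset_Icc_self hx)

/-- The difference of two phases whose potentials differ by a constant solves a linear equation. -/
lemma hasDerivAt_sub {δ : ℝ} (h : IsPruferPhase q θ)
    (h' : IsPruferPhase (fun x => q x + δ) θ') (x : ℝ) :
    HasDerivAt (fun x => θ' x - θ x) ((q x - 1) * (sin (θ' x + θ x) * sinc (θ' x - θ x)) *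
      (θ' x - θ x) + δ * sin (θ' x) ^ 2) x := by
  refine ((h' x).sub (h x)).congr_deriv ?_
  linear_combination (q x - 1) * sin_sq_sub_sin_sq_eq (θ' x) (θ x)

lemma lt_of_add_const {δ : ℝ} (hq : Continuous q) (hδ : 0 < δ) (h : IsPruferPhase q θ)
    (h' : IsPruferPhase (fun x => q x + δ) θ') (h0 : θ 0 = θ' 0) (ha : 0 < a) : θ a < θ' a := by
  set p : ℝ → ℝ := fun x => (q x - 1) * (sin (θ' x + θ x) * sinc (θ' x - θ x)) with hp
  have hpc : Continuous p := by
    have := h.continuous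
    have := h'.continuous
    have := continuous_sinc
    fun_prop
  set P : ℝ → ℝ := fun x => ∫ t in (0 : ℝ)..x, p t
  have hP : ∀ x, HasDerivAt P (p x) x := fun x => hpc.integral_hasStrictDerivAt 0 x |>.hasDerivAt
  set g : ℝ → ℝ := fun x => exp (-P x) * (θ' x - θ x) with hg
  have hgd : ∀ x, HasDerivAt g (exp (-P x) * (δ * sin (θ' x) ^ 2)) x := fun x => by
    refine ((hP x).neg.exp.mul (h.hasDerivAt_sub h' x)).congr_deriv ?_
    simp only [hp, Pi.neg_apply]
    ring
  have hmono : Monotone g := monotone_of_deriv_nonneg (fun x => (hgd x).differentiableAt)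
    fun x => by rw [(hgd x).deriv]; positivity
  have hg0 : g 0 = 0 := by simp [hg, h0]
  have hne : g a ≠ 0 := by
    intro hga
    have hsin : ∀ x ∈ Ioo 0 a, sin (θ' x) = 0 := fun x hx => by
      have hz : HasDerivAt g 0 x := (hasDerivAt_const x (0 : ℝ)).congr_of_eventuallyEq <| by
        filter_upwards [Ioo_mem_nhds hx.1 hx.2] with z hz
        exact le_antisymm (hga ▸ hmono hz.2.le) (hg0 ▸ hmono hz.1.le)
      have := (hgd x).unique hz
      simpa [hδ.ne', (exp_pos _).ne'] using this
    have hx : a / 2 ∈ Ioo 0 a := ⟨by linarith, by linarith⟩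
    have h1 : HasDerivAt (fun x => sin (θ' x)) 0 (a / 2) :=
      (hasDerivAt_const _ (0 : ℝ)).congr_of_eventuallyEq <| by
        filter_upwards [Ioo_mem_nhds hx.1 hx.2] with z hz using hsin z hz
    have h2 := (h' (a / 2)).sin.unique h1
    have h3 := sin_sq_add_cos_sq (θ' (a / 2))
    simp only [hsin _ hx] at h2 h3
    simp_all
  have hga : 0 < g a := (hg0 ▸ hmono ha.le).lt_of_ne hne.symm
  exact sub_pos.1 (pos_of_mul_pos_right hga (exp_pos _).le)

/-- The terminal phase depends continuously on the spectral parameter. -/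
lemma continuous_param {V : ℝ → ℝ} (hV : Continuous V) {θ : ℝ → ℝ → ℝ}
    (h : ∀ μ, IsPruferPhase (fun x => V x + μ) (θ μ)) (h0 : ∀ μ, θ μ 0 = 0) (ha : 0 ≤ a) :
    Continuous fun μ => θ μ a := by
  refine continuous_iff_continuousAt.2 fun μ => ?_
  obtain ⟨C, hC⟩ := isCompact_Icc.exists_bound_of_continuousOn
    (s := Icc 0 a) (f := fun t => V t + μ - 1) (by fun_prop)
  have hbound : ∀ ν, dist (θ ν a) (θ μ a) ≤ gronwallBound 0 C |ν - μ| (a - 0) := by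
    intro ν
    have hν : IsPruferPhase (fun x => V x + μ + (ν - μ)) (θ ν) := by
      simpa only [add_add_sub_cancel] using h ν
    have hd := (h μ).hasDerivAt_sub hν
    refine norm_le_gronwallBound_of_norm_deriv_right_le (f := fun x => θ ν x - θ μ x)
      (fun x _ => (hd x).continuousAt.continuousWithinAt) (fun x _ => (hd x).hasDerivWithinAt)
      (by simp [h0]) (fun x hx => ?_) a ⟨ha, le_rfl⟩
    refine (norm_add_le _ _).trans (add_le_add ?_ ?_)
    · rw [norm_mul, norm_mul]
      refine mul_le_mul_of_nonneg_right ?_ (norm_nonneg _)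
      exact (mul_le_of_le_one_right (norm_nonneg _) (abs_sin_mul_sinc_le_one _ _)).trans
        (hC x (Ico_subset_Icc_self hx))
    · rw [Real.norm_eq_abs, abs_mul, abs_of_nonneg (sq_nonneg (sin _))]
      exact mul_le_of_le_one_right (abs_nonneg _) (sin_sq_le_one _)
  refine tendsto_iff_dist_tendsto_zero.2 (squeeze_zero (fun _ => dist_nonneg) hbound ?_)
  have : Continuous fun ν => gronwallBound 0 C |ν - μ| (a - 0) :=
    (gronwallBound_continuous_ε 0 C (a - 0)).comp (by fun_prop)
  simpa [gronwallBound_ε0_δ0] using this.tendsto μ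

/-- The Prüfer amplitude attached to a phase. -/
lemma exists_amplitude (hq : Continuous q) (h : IsPruferPhase q θ) :
    ∃ r : ℝ → ℝ, (∀ x, 0 < r x) ∧
      (∀ x, HasDerivAt (fun x => r x * sin (θ x)) (r x * cos (θ x)) x) ∧
      ∀ x, HasDerivAt (fun x => r x * cos (θ x)) (-(q x * (r x * sin (θ x)))) x := by
  have hc := h.continuous
  set p : ℝ → ℝ := fun x => (1 - q x) * (sin (θ x) * cos (θ x))
  have hpc : Continuous p := by fun_prop
  have hr : ∀ x, HasDerivAt (fun x => exp (∫ t in (0 : ℝ)..x, p t)) _ x :=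
    fun x => (hpc.integral_hasStrictDerivAt 0 x).hasDerivAt.exp
  refine ⟨fun x => exp (∫ t in (0 : ℝ)..x, p t), fun x => exp_pos _, fun x => ?_, fun x => ?_⟩
  · refine ((hr x).mul (h x).sin).congr_deriv ?_
    simp only [p]
    ring
  · refine ((hr x).mul (h x).cos).congr_deriv ?_
    simp only [p]
    linear_combination exp (∫ t in (0 : ℝ)..x, p t) * sin (θ x) * (1 - q x) *
      sin_sq_add_cos_sq (θ x)

end IsPruferPhase

/-- The Wronskian of two solutions of `y'' + q y = 0` is constant. -/
lemma wronskian_eq {q u u' v v' : ℝ → ℝ} (hu : ∀ x, HasDerivAt u (u' x) x)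
    (hu' : ∀ x, HasDerivAt u' (-(q x * u x)) x) (hv : ∀ x, HasDerivAt v (v' x) x)
    (hv' : ∀ x, HasDerivAt v' (-(q x * v x)) x) (x y : ℝ) :
    u x * v' x - u' x * v x = u y * v' y - u' y * v y := by
  have h : ∀ x, HasDerivAt (fun x => u x * v' x - u' x * v x) 0 x := fun x => by
    refine (((hu x).mul (hv' x)).sub ((hu' x).mul (hv x))).congr_deriv ?_
    ring
  exact is_const_of_deriv_eq_zero (fun x => (h x).differentiableAt) (fun x => (h x).deriv) x y

lemma contDiff_of_hasDerivAt_of_hasDerivAt {q u u' : ℝ → ℝ} (hq : ContDiff ℝ (⊤ : ℕ∞) q)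
    (hu : ∀ x, HasDerivAt u (u' x) x) (hu' : ∀ x, HasDerivAt u' (-(q x * u x)) x) :
    ContDiff ℝ (⊤ : ℕ∞) u := by
  have hd : deriv u = u' := funext fun x => (hu x).deriv
  have hd' : deriv u' = fun x => -(q x * u x) := funext fun x => (hu' x).deriv
  have key : ∀ n : ℕ, ContDiff ℝ n u ∧ ContDiff ℝ n u' := by
    intro n
    induction n with
    | zero =>
      simp only [Nat.cast_zero, contDiff_zero]
      exact ⟨continuous_iff_continuousAt.2 fun x => (hu x).continuousAt,
        continuous_iff_continuousAt.2 fun x => (hu' x).continuousAt⟩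
    | succ n ih =>
      have hqn : ContDiff ℝ n q := hq.of_le (by exact_mod_cast le_top)
      push_cast
      rw [contDiff_succ_iff_deriv, contDiff_succ_iff_deriv, hd, hd']
      exact ⟨⟨fun x => (hu x).differentiableAt, by simp, ih.2⟩,
        fun x => (hu' x).differentiableAt, by simp, (hqn.mul ih.1).neg⟩
  exact contDiff_infty.2 fun n => (key n).1

lemma IsPruferPhase.exists_isDirichletEigenfunction {V θ : ℝ → ℝ} {a μ : ℝ}
    (hV : ContDiff ℝ (⊤ : ℕ∞) V) (h : IsPruferPhase (fun x => V x + μ) θ) (h0 : θ 0 = 0)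
    (ha : sin (θ a) = 0) : ∃ f, IsDirichletEigenfunction a V μ f := by
  have hq : ContDiff ℝ (⊤ : ℕ∞) fun x => V x + μ := hV.add contDiff_const
  obtain ⟨r, hr, hy, hy'⟩ := h.exists_amplitude hq.continuous
  refine ⟨_, contDiff_of_hasDerivAt_of_hasDerivAt hq hy hy', fun hz => ?_, fun x => ?_,
    by simp [h0], by simp [ha]⟩
  · have h1 := (hy 0).deriv
    rw [hz] at h1
    simp [h0, (hr 0).ne] at h1
  · rw [funext fun x => (hy x).deriv, (hy' x).deriv]
    ring

/-- A Dirichlet eigenfunction vanishes exactly where its Prüfer phase is a multiple of `π`. -/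
lemma IsDirichletEigenfunction.eq_zero_iff_sin_eq_zero {V f θ : ℝ → ℝ} {a μ : ℝ}
    (hV : Continuous V) (hf : IsDirichletEigenfunction a V μ f)
    (h : IsPruferPhase (fun x => V x + μ) θ) (h0 : θ 0 = 0) (x : ℝ) :
    f x = 0 ↔ sin (θ x) = 0 := by
  obtain ⟨hsm, hne, hode, hf0, -⟩ := hf
  have hq : Continuous fun x => V x + μ := by fun_prop
  have hfd : ∀ x, HasDerivAt f (deriv f x) x := fun x =>
    (hsm.differentiable (by simp) x).hasDerivAt
  have hfd' : ∀ x, HasDerivAt (deriv f) (-((V x + μ) * f x)) x := fun x => by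
    have := ((contDiff_infty_iff_deriv.1 hsm).2.differentiable (by simp) x).hasDerivAt
    rwa [eq_neg_of_add_eq_zero_left (hode x)] at this
  obtain ⟨r, hr, hy, hy'⟩ := h.exists_amplitude hq
  obtain ⟨φ, hφ0, hφ⟩ := exists_isPruferPhase hq (π / 2)
  obtain ⟨s, hs, hz, hz'⟩ := hφ.exists_amplitude hq
  have w1 := fun x => wronskian_eq hfd hfd' hy hy' x 0
  have w2 := fun x => wronskian_eq hz hz' hfd hfd' x 0
  have w3 := fun x => wronskian_eq hy hy' hz hz' x 0
  simp only [h0, hφ0, hf0, sin_zero, cos_zero, sin_pi_div_two, cos_pi_div_two, mul_zero, mul_one,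
    zero_mul, sub_zero, zero_sub] at w1 w2 w3
  have hfy : ∀ x, r 0 * f x = deriv f 0 * (r x * sin (θ x)) := fun x => by
    refine mul_left_cancel₀ (hs 0).ne' ?_
    linear_combination f x * w3 x + (s x * sin (φ x)) * w1 x + (r x * sin (θ x)) * w2 x
  have hd0 : deriv f 0 ≠ 0 := fun hd => hne <| funext fun x => by
    simpa [hd, (hr 0).ne'] using hfy x
  constructor
  · intro hx
    have := hfy x
    simpa [hx, hd0, (hr x).ne'] using this
  · intro hx
    simpa [hx, (hr 0).ne'] using hfy x

lemma Set.ncard_eq_of_image_eq_image_Iio {α β : Type*} {S : Set α} {g : α → β} {c : ℕ → β} {N : ℕ}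
    (hg : InjOn g S) (hc : Function.Injective c) (h : g '' S = c '' Iio N) : S.ncard = N := by
  rw [← hg.ncard_image, h, ncard_image_of_injective _ hc]
  simp [ncard_eq_toFinset_card']

/-- If `lam` is a Dirichlet eigenvalue and there are exactly `m` Dirichlet eigenvalues
strictly below `lam` (so `lam` is the `(m+1)`-st eigenvalue), then every Dirichlet
eigenfunction for `lam` has exactly `m + 2` zeros in `[0,a]`. -/
theorem dirichlet_eigenfunction_node_count (a : ℝ) (ha : 0 < a) (V : ℝ → ℝ)
    (hV : AnalyticOnNhd ℝ V Set.univ) (lam : ℝ)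
    (hlam : ∃ f, IsDirichletEigenfunction a V lam f) (m : ℕ)
    (hfin : {μ : ℝ | μ < lam ∧ ∃ f, IsDirichletEigenfunction a V μ f}.Finite)
    (hm : {μ : ℝ | μ < lam ∧ ∃ f, IsDirichletEigenfunction a V μ f}.ncard = m) :
    ∀ f, IsDirichletEigenfunction a V lam f →
      {x : ℝ | x ∈ Set.Icc 0 a ∧ f x = 0}.ncard = m + 2 := by
  intro f hf
  have hVs : ContDiff ℝ (⊤ : ℕ∞) V := contDiffOn_univ.1 (hV.contDiffOn uniqueDiffOn_univ)
  have hVc := hVs.continuous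
  choose θ h0 h using fun μ : ℝ =>
    exists_isPruferPhase (q := fun x => V x + μ) (by fun_prop) 0
  have hmono : StrictMono fun μ => θ μ a := fun μ ν hμν =>
    (h μ).lt_of_add_const (by fun_prop) (sub_pos.2 hμν)
      (by simpa only [add_add_sub_cancel] using h ν) ((h0 μ).trans (h0 ν).symm) ha
  have hcont := IsPruferPhase.continuous_param hVc h h0 ha.le
  have heig : ∀ μ, (∃ f, IsDirichletEigenfunction a V μ f) ↔ sin (θ μ a) = 0 := fun μ =>
    ⟨fun ⟨g, hg⟩ => (hg.eq_zero_iff_sin_eq_zero hVc (h μ) (h0 μ) a).1 hg.2.2.2.2,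
      (h μ).exists_isDirichletEigenfunction hVs (h0 μ)⟩
  have hpos : ∀ μ x, 0 < x → 0 < θ μ x := fun μ x => (h μ).pos (h0 μ)
  have natOf : ∀ μ x, 0 < x → sin (θ μ x) = 0 → ∃ k : ℕ, ((k : ℝ) + 1) * π = θ μ x := by
    intro μ x hx hs
    obtain ⟨k, hk⟩ := sin_eq_zero_iff.1 hs
    have hk0 : 0 < k := by
      have := hpos μ x hx
      rw [← hk] at this
      exact_mod_cast pos_of_mul_pos_left this pi_pos.le
    refine ⟨(k - 1).toNat, ?_⟩
    rw [← hk]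
    congr 1
    have : (((k - 1).toNat : ℤ) : ℝ) = ((k - 1 : ℤ) : ℝ) := by
      rw [Int.toNat_of_nonneg (by omega)]
    push_cast at this
    linarith
  obtain ⟨n, hn⟩ := natOf lam a ha ((heig lam).1 hlam)
  have hnm : n = m := by
    rw [← hm]
    symm
    refine Set.ncard_eq_of_image_eq_image_Iio (g := fun μ => θ μ a)
      (c := fun k => ((k : ℝ) + 1) * π) hmono.injective.injOn
      (fun i j hij => by simpa [pi_ne_zero] using hij) ?_
    ext t
    constructor
    · rintro ⟨μ, ⟨hμ, he⟩, rfl⟩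
      obtain ⟨k, hk⟩ := natOf μ a ha ((heig μ).1 he)
      refine ⟨k, ?_, hk⟩
      have hlt : θ μ a < θ lam a := hmono hμ
      rw [← hk, ← hn] at hlt
      have := lt_of_mul_lt_mul_right hlt pi_pos.le
      simpa using this
    · rintro ⟨k, hk, rfl⟩
      obtain ⟨C, hC⟩ := isCompact_Icc.exists_bound_of_continuousOn
        (s := Icc 0 a) hVc.continuousOn
      have hlow : θ (-C - 1) a ≤ π / 2 := (h _).le_pi_div_two (h0 _) ha.le fun x hx => by
        linarith [le_abs_self (V x), hC x hx, Real.norm_eq_abs (V x)]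
      have hkn : ((k : ℝ) + 1) * π < θ lam a := by
        rw [← hn]
        have : (k : ℝ) < n := by exact_mod_cast hk
        gcongr
      have hk1 : π / 2 ≤ ((k : ℝ) + 1) * π := by nlinarith [pi_pos, (Nat.cast_nonneg k : (0:ℝ) ≤ k)]
      obtain ⟨μ, hμ⟩ := mem_range_of_exists_le_of_exists_ge hcont
        ⟨_, hlow.trans hk1⟩ ⟨lam, hkn.le⟩
      refine ⟨μ, ⟨hmono.lt_iff_lt.1 (hμ.trans_lt hkn), (heig μ).2 ?_⟩, hμ⟩
      rw [show θ μ a = ((k + 1 : ℕ) : ℝ) * π by push_cast; exact hμ]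
      exact sin_nat_mul_pi _
  subst hnm
  have hcross : ∀ (k : ℕ) {x y : ℝ}, x < y → (k : ℝ) * π ≤ θ lam x → (k : ℝ) * π < θ lam y :=
    fun k x y hxy hx => by exact_mod_cast (h lam).int_mul_pi_lt k hxy (by exact_mod_cast hx)
  have hzero : ∀ x ∈ Icc 0 a, f x = 0 → ∃ k : ℕ, (k : ℝ) * π = θ lam x := by
    intro x hx hfx
    rcases hx.1.eq_or_lt with rfl | hx0
    · exact ⟨0, by simp [h0]⟩
    · obtain ⟨k, hk⟩ := natOf lam x hx0
        ((hf.eq_zero_iff_sin_eq_zero hVc (h lam) (h0 lam) x).1 hfx)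
      exact ⟨k + 1, by push_cast; exact hk⟩
  refine Set.ncard_eq_of_image_eq_image_Iio (g := θ lam) (c := fun k => (k : ℝ) * π) ?_
    (fun i j hij => by simpa [pi_ne_zero] using hij) ?_
  · rintro x ⟨hx, hfx⟩ y ⟨hy, hfy⟩ hxy
    obtain ⟨k, hk⟩ := hzero x hx hfx
    rcases lt_trichotomy x y with hlt | heq | hlt
    · exact absurd (hk.trans hxy) (hcross k hlt hk.le).ne
    · exact heq
    · exact absurd hk (hcross k hlt (hk.trans hxy).le).ne
  · ext t
    constructor
    · rintro ⟨x, ⟨hx, hfx⟩, rfl⟩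
      obtain ⟨k, hk⟩ := hzero x hx hfx
      refine ⟨k, ?_, hk⟩
      by_contra hkn
      have hkn' : n + 2 ≤ k := by simpa using hkn
      have hlt : ((k : ℝ)) * π ≤ θ lam a := by
        rcases hx.2.eq_or_lt with rfl | hxa
        · exact hk.le
        · exact (hcross k hxa hk.le).le
      rw [← hn] at hlt
      have := le_of_mul_le_mul_right hlt pi_pos
      have : k ≤ n + 1 := by exact_mod_cast this
      omega
    · rintro ⟨k, hk, rfl⟩
      have hkn : (k : ℝ) ≤ n + 1 := by
        have : k < n + 2 := hk
        exact_mod_cast (by omega : k ≤ n + 1)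
      obtain ⟨x, hx, hxk⟩ := intermediate_value_Icc ha.le (h lam).continuous.continuousOn
        (show (k : ℝ) * π ∈ Icc (θ lam 0) (θ lam a) from
          ⟨by rw [h0]; positivity, by rw [← hn]; gcongr⟩)
      exact ⟨x, ⟨hx, (hf.eq_zero_iff_sin_eq_zero hVc (h lam) (h0 lam) x).2
        (by rw [hxk]; exact sin_nat_mul_pi k)⟩, hxk⟩
end

section
/- Let a > 0 and let V : ℝ → ℝ be real-analytic and a-periodic. If f and g are two periodic eigenfunctions of L = −d²/dx² − V associated to the same eigenvalue λ, then f and g have the same number of zeros in the half-open interval [0,a). -/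
/-- `f` is a periodic eigenfunction of `L = -d²/dx² - V` with eigenvalue `lam`. -/
def IsPeriodicEigenfunction (a : ℝ) (V : ℝ → ℝ) (lam : ℝ) (f : ℝ → ℝ) : Prop :=
  ContDiff ℝ (⊤ : ℕ∞) f ∧ f ≠ 0 ∧
    (∀ x : ℝ, deriv (deriv f) x + (V x + lam) * f x = 0) ∧ ∀ x : ℝ, f (x + a) = f x

/-- For a predicate invariant under translation by `p > 0`, the number of points of a half-open
interval of length `p` satisfying it does not depend on the interval. -/
theorem ncard_Ico_eq_of_periodic {p : ℝ} (hp : 0 < p) {P : ℝ → Prop}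
    (hP : Function.Periodic P p) (b c : ℝ) :
    {t : ℝ | t ∈ Set.Ico b (b + p) ∧ P t}.ncard =
      {t : ℝ | t ∈ Set.Ico c (c + p) ∧ P t}.ncard := by
  have hmod : ∀ d t, P (toIcoMod hp d t) = P t := fun d t => hP.sub_zsmul_eq _
  have hinv : ∀ d e t, t ∈ Set.Ico d (d + p) → toIcoMod hp d (toIcoMod hp e t) = t := by
    intro d e t ht
    rw [toIcoMod_toIcoMod]
    exact (toIcoMod_eq_self hp).2 ht
  refine Set.ncard_congr (fun t _ => toIcoMod hp c t) ?_ ?_ ?_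
  · rintro t ⟨-, hPt⟩
    exact ⟨toIcoMod_mem_Ico hp c t, (hmod c t).symm ▸ hPt⟩
  · rintro s t ⟨hs, -⟩ ⟨ht, -⟩ hst
    rw [← hinv b c s hs, ← hinv b c t ht]
    exact congrArg (toIcoMod hp b) hst
  · rintro t ⟨ht, hPt⟩
    exact ⟨toIcoMod hp b t, ⟨toIcoMod_mem_Ico hp b t, (hmod b t).symm ▸ hPt⟩, hinv c b t ht⟩

/-- A nowhere vanishing `C¹` curve in `ℂ` has a differentiable logarithm. -/
theorem exists_hasDerivAt_log {u u' : ℝ → ℂ} (hu : ∀ x, HasDerivAt u (u' x) x)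
    (hu' : Continuous u') (hne : ∀ x, u x ≠ 0) :
    ∃ F : ℝ → ℂ, (∀ x, HasDerivAt F (u' x / u x) x) ∧ ∀ x, u x = Complex.exp (F x) := by
  have hcont : Continuous u := continuous_iff_continuousAt.2 fun x => (hu x).continuousAt
  have hq : Continuous fun x => u' x / u x := hu'.div hcont hne
  obtain ⟨F, hF, hF0⟩ : ∃ F : ℝ → ℂ, (∀ x, HasDerivAt F (u' x / u x) x) ∧
      F 0 = Complex.log (u 0) :=
    ⟨fun x => (∫ t in (0 : ℝ)..x, u' t / u t) + Complex.log (u 0),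
      fun x => (hq.integral_hasStrictDerivAt 0 x).hasDerivAt.add_const _, by simp⟩
  refine ⟨F, hF, fun x => ?_⟩
  have hderiv : ∀ y, HasDerivAt (fun y => u y * Complex.exp (-F y)) 0 y := by
    intro y
    convert! (hu y).mul (hF y).neg.cexp using 1
    field_simp [hne y]
    ring
  have hconst := is_const_of_deriv_eq_zero (fun y => (hderiv y).differentiableAt)
    (fun y => (hderiv y).deriv) x 0
  simp only [hF0, Complex.exp_neg, Complex.exp_log (hne 0), mul_inv_cancel₀ (hne 0)] at hconst
  exact (mul_inv_eq_one₀ (Complex.exp_ne_zero _)).1 hconst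

/-- Two functions with positive Wronskian, seen as the coordinates of a plane curve which closes
up over `[0, a]`, have the same number of zeros in `[0, a)`. -/
theorem ncard_zeros_eq_of_wronskian_pos {a : ℝ} (ha : 0 < a) {f f' g g' : ℝ → ℝ}
    (hf : ∀ x, HasDerivAt f (f' x) x) (hg : ∀ x, HasDerivAt g (g' x) x)
    (hf' : Continuous f') (hg' : Continuous g') (hfa : f a = f 0) (hga : g a = g 0)
    (hW : ∀ x, 0 < f x * g' x - f' x * g x) :
    {x : ℝ | x ∈ Set.Ico 0 a ∧ f x = 0}.ncard =
      {x : ℝ | x ∈ Set.Ico 0 a ∧ g x = 0}.ncard := by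
  have hne : ∀ x, (⟨f x, g x⟩ : ℂ) ≠ 0 := by
    intro x h
    have h1 : f x = 0 := congrArg Complex.re h
    have h2 : g x = 0 := congrArg Complex.im h
    simpa [h1, h2] using hW x
  have hu : ∀ x, HasDerivAt (fun x => (⟨f x, g x⟩ : ℂ)) ⟨f' x, g' x⟩ x := by
    intro x
    simp only [Complex.mk_eq_add_mul_I]
    exact (hf x).ofReal_comp.add ((hg x).ofReal_comp.mul_const Complex.I)
  have hu' : Continuous fun x => (⟨f' x, g' x⟩ : ℂ) := by
    simp only [Complex.mk_eq_add_mul_I]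
    fun_prop
  obtain ⟨F, hF, hexp⟩ := exists_hasDerivAt_log hu hu' hne
  obtain ⟨θ, hθF⟩ : ∃ θ : ℝ → ℝ, ∀ x, θ x = (F x).im := ⟨_, fun _ => rfl⟩
  have hfθ : ∀ x, f x = Real.exp (F x).re * Real.cos (θ x) := fun x => by
    rw [hθF, ← Complex.exp_re, ← hexp]
  have hgθ : ∀ x, g x = Real.exp (F x).re * Real.sin (θ x) := fun x => by
    rw [hθF, ← Complex.exp_im, ← hexp]
  have hθ : ∀ x, HasDerivAt θ ((f x * g' x - f' x * g x) / (f x ^ 2 + g x ^ 2)) x := by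
    intro x
    have h := Complex.imCLM.hasFDerivAt.comp_hasDerivAt x (hF x)
    rw [show θ = Complex.imCLM ∘ F from funext hθF]
    convert! h using 1
    simp only [Complex.imCLM_apply, Complex.div_im, Complex.normSq_mk]
    ring
  have hmono : StrictMono θ := by
    refine strictMono_of_deriv_pos fun x => ?_
    rw [(hθ x).deriv]
    refine div_pos (hW x) ?_
    rw [hfθ, hgθ, mul_pow, mul_pow, ← mul_add, Real.cos_sq_add_sin_sq]
    positivity
  have hcont : Continuous θ := continuous_iff_continuousAt.2 fun x => (hθ x).continuousAt
  have himage : ∀ P : ℝ → Prop, {x : ℝ | x ∈ Set.Ico 0 a ∧ P (θ x)}.ncard =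
      {t : ℝ | t ∈ Set.Ico (θ 0) (θ 0 + (θ a - θ 0)) ∧ P t}.ncard := by
    intro P
    rw [← Set.ncard_image_of_injective _ hmono.injective]
    congr 1
    ext t
    rw [add_sub_cancel]
    constructor
    · rintro ⟨x, ⟨⟨h0, h1⟩, hP⟩, rfl⟩
      exact ⟨⟨hmono.monotone h0, hmono h1⟩, hP⟩
    · rintro ⟨ht, hP⟩
      obtain ⟨x, hx, rfl⟩ := intermediate_value_Ico ha.le hcont.continuousOn ht
      exact ⟨x, ⟨hx, hP⟩, rfl⟩
  have hexpa : Complex.exp (F a) = Complex.exp (F 0) := by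
    rw [← hexp, ← hexp, hfa, hga]
  have hper : ∀ t, Real.cos (t + (θ a - θ 0)) = Real.cos t := by
    obtain ⟨n, hn⟩ := Complex.exp_eq_exp_iff_exists_int.1 hexpa
    intro t
    have hC : θ a - θ 0 = n * (2 * Real.pi) := by
      rw [hθF, hθF, hn]
      simp
    rw [hC, Real.cos_add_int_mul_two_pi]
  have hfz : ∀ x, f x = 0 ↔ Real.cos (θ x) = 0 := fun x => by
    rw [hfθ, mul_eq_zero, or_iff_right (Real.exp_ne_zero _)]
  have hgz : ∀ x, g x = 0 ↔ Real.cos (θ x - Real.pi / 2) = 0 := fun x => by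
    rw [hgθ, mul_eq_zero, or_iff_right (Real.exp_ne_zero _), Real.cos_sub_pi_div_two]
  simp only [hfz, hgz]
  rw [himage fun t => Real.cos t = 0, himage fun t => Real.cos (t - Real.pi / 2) = 0,
    ncard_Ico_eq_of_periodic (sub_pos.2 (hmono ha)) (fun t => by simp only [hper]) (θ 0)
      (θ 0 - Real.pi / 2)]
  refine Eq.trans (congrArg Set.ncard (Set.ext fun t => ?_))
    (Set.ncard_image_of_injective _ (sub_left_injective (b := Real.pi / 2)))
  constructor
  · rintro ⟨⟨h0, h1⟩, h⟩
    refine ⟨t + Real.pi / 2, ⟨⟨by linarith, by linarith⟩, ?_⟩, add_sub_cancel_right _ _⟩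
    rwa [add_sub_cancel_right]
  · rintro ⟨s, ⟨⟨h0, h1⟩, h⟩, rfl⟩
    exact ⟨⟨by linarith, by linarith⟩, h⟩

/-- A solution of `f'' + q f = 0` with `q` bounded which vanishes to first order at a point is
zero. -/
theorem eq_zero_of_second_order_linear {q f f' : ℝ → ℝ} {K : NNReal} (hq : ∀ x, ‖q x‖ ≤ K)
    (hf : ∀ x, HasDerivAt f (f' x) x) (hf' : ∀ x, HasDerivAt f' (-(q x * f x)) x) {x₀ : ℝ}
    (h0 : f x₀ = 0) (h0' : f' x₀ = 0) : f = 0 := by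
  have hlip : ∀ t, LipschitzOnWith (max 1 K) (fun p : ℝ × ℝ => (p.2, -(q t * p.1))) Set.univ := by
    intro t
    refine (LipschitzWith.prodMk LipschitzWith.prod_snd ?_).lipschitzOnWith
    refine LipschitzWith.of_dist_le_mul fun p p' => ?_
    rw [dist_neg_neg, Real.dist_eq, ← mul_sub, abs_mul]
    exact mul_le_mul (hq t) (le_max_left _ _) (abs_nonneg _) K.2
  have h := ODE_solution_unique_univ (f := fun x => (f x, f' x)) (g := fun _ => 0) (t₀ := x₀) hlip
    (fun t => ⟨(hf t).prodMk (hf' t), Set.mem_univ _⟩)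
    (fun t => ⟨by simpa [Prod.mk_zero_zero] using hasDerivAt_const t (0 : ℝ × ℝ), Set.mem_univ _⟩)
    (by simp [h0, h0'])
  funext x
  exact congrArg Prod.fst (congrFun h x)

theorem IsPeriodicEigenfunction.hasDerivAt {a lam : ℝ} {V f : ℝ → ℝ}
    (hf : IsPeriodicEigenfunction a V lam f) (x : ℝ) : HasDerivAt f (deriv f x) x :=
  (hf.1.differentiable (by simp) x).hasDerivAt

theorem IsPeriodicEigenfunction.hasDerivAt_deriv {a lam : ℝ} {V f : ℝ → ℝ}
    (hf : IsPeriodicEigenfunction a V lam f) (x : ℝ) :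
    HasDerivAt (deriv f) (-((V x + lam) * f x)) x := by
  rw [← eq_neg_of_add_eq_zero_left (hf.2.2.1 x)]
  exact ((contDiff_infty_iff_deriv.1 hf.1).2.differentiable (by simp) x).hasDerivAt

theorem IsPeriodicEigenfunction.continuous_deriv {a lam : ℝ} {V f : ℝ → ℝ}
    (hf : IsPeriodicEigenfunction a V lam f) : Continuous (deriv f) :=
  (contDiff_infty_iff_deriv.1 hf.1).2.continuous

theorem IsPeriodicEigenfunction.apply_eq_apply_zero {a lam : ℝ} {V f : ℝ → ℝ}
    (hf : IsPeriodicEigenfunction a V lam f) : f a = f 0 := by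
  simpa using hf.2.2.2 0

/-- An eigenfunction of a bounded potential has no double zeros. -/
theorem IsPeriodicEigenfunction.deriv_ne_zero {a lam : ℝ} {V f : ℝ → ℝ}
    (hf : IsPeriodicEigenfunction a V lam f) {K : NNReal} (hV : ∀ x, ‖V x + lam‖ ≤ K) {x : ℝ}
    (hx : f x = 0) : deriv f x ≠ 0 := fun h =>
  hf.2.1 (eq_zero_of_second_order_linear hV hf.hasDerivAt hf.hasDerivAt_deriv hx h)

/-- The Wronskian of two eigenfunctions with the same eigenvalue is constant. -/
theorem IsPeriodicEigenfunction.wronskian_eq {a lam : ℝ} {V f g : ℝ → ℝ}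
    (hf : IsPeriodicEigenfunction a V lam f) (hg : IsPeriodicEigenfunction a V lam g) (x y : ℝ) :
    f x * deriv g x - deriv f x * g x = f y * deriv g y - deriv f y * g y := by
  have hderiv : ∀ x, HasDerivAt (fun x => f x * deriv g x - deriv f x * g x) 0 x := by
    intro x
    convert! ((hf.hasDerivAt x).mul (hg.hasDerivAt_deriv x)).sub
      ((hf.hasDerivAt_deriv x).mul (hg.hasDerivAt x)) using 1
    ring
  exact is_const_of_deriv_eq_zero (fun x => (hderiv x).differentiableAt)
    (fun x => (hderiv x).deriv) x y

/-- Two periodic eigenfunctions associated to the same eigenvalue have the same number of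
zeros in `[0,a)`. -/
theorem equal_eigenvalue_equal_node_count (a : ℝ) (ha : 0 < a) (V : ℝ → ℝ)
    (hV : AnalyticOnNhd ℝ V Set.univ) (hVper : ∀ x : ℝ, V (x + a) = V x) (lam : ℝ)
    (f g : ℝ → ℝ) (hf : IsPeriodicEigenfunction a V lam f)
    (hg : IsPeriodicEigenfunction a V lam g) :
    {x : ℝ | x ∈ Set.Ico 0 a ∧ f x = 0}.ncard =
      {x : ℝ | x ∈ Set.Ico 0 a ∧ g x = 0}.ncard := by
  rcases lt_trichotomy (f 0 * deriv g 0 - deriv f 0 * g 0) 0 with hW | hW | hW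
  · refine (ncard_zeros_eq_of_wronskian_pos ha hg.hasDerivAt hf.hasDerivAt hg.continuous_deriv
      hf.continuous_deriv hg.apply_eq_apply_zero hf.apply_eq_apply_zero fun x => ?_).symm
    linarith [hf.wronskian_eq hg x 0]
  · have hVc : Continuous V := continuousOn_univ.1 hV.continuousOn
    obtain ⟨K, hK⟩ : ∃ K : NNReal, ∀ x, ‖V x + lam‖ ≤ K := by
      have hper : Function.Periodic (fun x => V x + lam) a := fun x => by simp only [hVper]
      obtain ⟨C, hC⟩ := isBounded_iff_forall_norm_le.1
        (hper.isBounded_of_continuous ha.ne' (hVc.add continuous_const))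
      exact ⟨C.toNNReal, fun x => (hC _ (Set.mem_range_self x)).trans (Real.le_coe_toNNReal C)⟩
    have hiff : ∀ x, f x = 0 ↔ g x = 0 := by
      intro x
      have h := (hf.wronskian_eq hg x 0).trans hW
      constructor
      · intro hx
        simpa [hx, hf.deriv_ne_zero hK hx] using h
      · intro hx
        simpa [hx, hg.deriv_ne_zero hK hx] using h
    simp only [hiff]
  · refine ncard_zeros_eq_of_wronskian_pos ha hf.hasDerivAt hg.hasDerivAt hf.continuous_deriv
      hg.continuous_deriv hf.apply_eq_apply_zero hg.apply_eq_apply_zero fun x => ?_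
    rwa [hf.wronskian_eq hg x 0]
end

section
/- Let a > 0 and let V : ℝ → ℝ be real-analytic, a-periodic and even (V(−x) = V(x) for all x). Let λ < μ be real numbers and let f, g be periodic eigenfunctions of L = −d²/dx² − V for λ and μ respectively, both satisfying f'(0) = 0 and g'(0) = 0 (so both are even functions of x). If f has n zeros in [0,a) and g has m zeros in [0,a), then m ≥ n + 2. -/
open Set Filter Topology

/-- The function `f` solves the Hill equation with potential `Q`, and its derivative is the second
function given. -/
def SolvesHill (Q f f' : ℝ → ℝ) : Prop :=
  ∀ x, HasDerivAt f (f' x) x ∧ HasDerivAt f' (-(Q x * f x)) x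

theorem SolvesHill.neg {Q f f' : ℝ → ℝ} (h : SolvesHill Q f f') :
    SolvesHill Q (fun x => -f x) (fun x => -f' x) := by
  intro x
  refine ⟨(h x).1.neg, (h x).2.neg.congr_deriv (by ring)⟩

theorem SolvesHill.eq_of_eq_at {Q f f' g g' : ℝ → ℝ} {K : ℝ} (hQ : ∀ x, |Q x| ≤ K)
    (hf : SolvesHill Q f f') (hg : SolvesHill Q g g') {c : ℝ} (h₀ : f c = g c)
    (h₁ : f' c = g' c) : f = g ∧ f' = g' := by
  have key : (fun t => (f t, f' t)) = fun t => (g t, g' t) := by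
    refine ODE_solution_unique_univ (v := fun t y => (y.2, -(Q t * y.1)))
      (s := fun _ => univ) (K := Real.toNNReal (max 1 K)) (t₀ := c) ?_
      (fun t => ⟨(hf t).1.prodMk (hf t).2, mem_univ _⟩)
      (fun t => ⟨(hg t).1.prodMk (hg t).2, mem_univ _⟩) (by simp [h₀, h₁])
    intro t
    refine LipschitzOnWith.of_dist_le_mul fun x _ y _ => ?_
    rw [Real.coe_toNNReal _ (le_max_of_le_left zero_le_one), Prod.dist_eq, Prod.dist_eq]
    simp only [Real.dist_eq]
    have hQx : |-(Q t * x.1) - -(Q t * y.1)| = |Q t| * |x.1 - y.1| := by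
      rw [← abs_mul, ← abs_neg]
      congr 1
      ring
    rw [hQx]
    refine max_le ?_ ?_
    · calc |x.2 - y.2| = 1 * |x.2 - y.2| := (one_mul _).symm
        _ ≤ _ := mul_le_mul (le_max_left _ _) (le_max_right _ _) (abs_nonneg _)
          (le_max_of_le_left zero_le_one)
    · exact mul_le_mul ((hQ t).trans (le_max_right _ _)) (le_max_left _ _) (abs_nonneg _)
        (le_max_of_le_left zero_le_one)
  exact ⟨funext fun t => congrArg Prod.fst (congrFun key t),
    funext fun t => congrArg Prod.snd (congrFun key t)⟩

theorem SolvesHill.deriv_ne_zero {Q f f' : ℝ → ℝ} {K : ℝ} (hQ : ∀ x, |Q x| ≤ K)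
    (hf : SolvesHill Q f f') (hne : f ≠ 0) {c : ℝ} (hc : f c = 0) : f' c ≠ 0 := by
  intro h
  have hz : SolvesHill Q (fun _ => 0) (fun _ => 0) := fun x =>
    ⟨hasDerivAt_const x 0, (hasDerivAt_const x 0).congr_deriv (by simp)⟩
  exact hne (hf.eq_of_eq_at hQ hz hc h).1

theorem SolvesHill.comp_const_sub {Q f f' : ℝ → ℝ} (hf : SolvesHill Q f f') {a : ℝ}
    (hQ : ∀ x, Q (a - x) = Q x) :
    SolvesHill Q (fun x => f (a - x)) (fun x => -f' (a - x)) := by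
  intro x
  refine ⟨(hf (a - x)).1.comp_const_sub a x, ?_⟩
  exact ((hf (a - x)).2.comp_const_sub a x).neg.congr_deriv (by rw [hQ]; ring)

theorem SolvesHill.finite_zeros {Q f f' : ℝ → ℝ} {K : ℝ} (hQ : ∀ x, |Q x| ≤ K)
    (hf : SolvesHill Q f f') (hne : f ≠ 0) (p q : ℝ) :
    {x | x ∈ Icc p q ∧ f x = 0}.Finite := by
  by_contra hinf
  obtain ⟨c, -, hc⟩ := Set.Infinite.exists_accPt_of_subset_isCompact hinf
    (isCompact_Icc (a := p) (b := q)) fun x hx => hx.1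
  rw [accPt_iff_frequently_nhdsNE] at hc
  have hc0 : f c = 0 := by
    by_contra h
    have h1 : ∀ᶠ x in 𝓝 c, f x ≠ 0 := (hf c).1.continuousAt.eventually_ne h
    exact hc ((h1.filter_mono nhdsWithin_le_nhds).mono fun x hx hx' => hx hx'.2)
  exact hc (((hf c).1.eventually_ne (c := 0) (hf.deriv_ne_zero hQ hne hc0)).mono
    fun x hx hx' => hx hx'.2)

theorem HasDerivAt.nonneg_of_pos_right {f : ℝ → ℝ} {d p q : ℝ} (hf : HasDerivAt f d p)
    (hpq : p < q) (h0 : f p = 0) (hpos : ∀ x ∈ Ioo p q, 0 < f x) : 0 ≤ d := by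
  have ht := (hasDerivWithinAt_iff_tendsto_slope' (s := Ioi p) (lt_irrefl p)).1
    hf.hasDerivWithinAt
  refine ge_of_tendsto ht ?_
  filter_upwards [Ioo_mem_nhdsGT hpq] with x hx
  rw [slope_def_field, h0, sub_zero]
  exact div_nonneg (hpos x hx).le (sub_nonneg.2 hx.1.le)

theorem HasDerivAt.nonpos_of_pos_left {f : ℝ → ℝ} {d p q : ℝ} (hf : HasDerivAt f d q)
    (hpq : p < q) (h0 : f q = 0) (hpos : ∀ x ∈ Ioo p q, 0 < f x) : d ≤ 0 := by
  have ht := (hasDerivWithinAt_iff_tendsto_slope' (s := Iio q) (lt_irrefl q)).1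
    hf.hasDerivWithinAt
  refine le_of_tendsto ht ?_
  filter_upwards [Ioo_mem_nhdsLT hpq] with x hx
  rw [slope_def_field, h0, sub_zero]
  exact div_nonpos_of_nonneg_of_nonpos (hpos x hx).le (sub_nonpos.2 hx.2.le)

theorem nonneg_on_Icc_of_pos_on_Ioo {f : ℝ → ℝ} (hf : Continuous f) {p q : ℝ} (hpq : p < q)
    (hpos : ∀ x ∈ Ioo p q, 0 < f x) : ∀ x ∈ Icc p q, 0 ≤ f x := by
  rw [← closure_Ioo hpq.ne]
  exact closure_minimal (fun x hx => (hpos x hx).le) (isClosed_le continuous_const hf)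

theorem SolvesHill.continuous {Q f f' : ℝ → ℝ} (hf : SolvesHill Q f f') : Continuous f :=
  continuous_iff_continuousAt.2 fun x => (hf x).1.continuousAt

theorem SolvesHill.not_both_pos {Q R f f' g g' : ℝ → ℝ} (hQR : ∀ x, Q x < R x)
    (hf : SolvesHill Q f f') (hg : SolvesHill R g g') {p q : ℝ} (hpq : p < q)
    (hp : f p = 0 ∨ f' p = 0 ∧ g' p = 0) (hq : f q = 0 ∨ f' q = 0 ∧ g' q = 0)
    (hfpos : ∀ x ∈ Ioo p q, 0 < f x) (hgpos : ∀ x ∈ Ioo p q, 0 < g x) : False := by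
  have hW : ∀ x, HasDerivAt (fun x => f x * g' x - f' x * g x)
      ((Q x - R x) * (f x * g x)) x := fun x =>
    (((hf x).1.mul (hg x).2).sub ((hf x).2.mul (hg x).1)).congr_deriv (by ring)
  have hanti : StrictAntiOn (fun x => f x * g' x - f' x * g x) (Icc p q) := by
    refine strictAntiOn_of_deriv_neg (convex_Icc p q)
      (fun x _ => (hW x).continuousAt.continuousWithinAt) fun x hx => ?_
    rw [interior_Icc] at hx
    rw [(hW x).deriv]
    exact mul_neg_of_neg_of_pos (sub_neg.2 (hQR x)) (mul_pos (hfpos x hx) (hgpos x hx))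
  have hlt := hanti (left_mem_Icc.2 hpq.le) (right_mem_Icc.2 hpq.le) hpq
  have hg0 := nonneg_on_Icc_of_pos_on_Ioo hg.continuous hpq hgpos
  have hWp : f p * g' p - f' p * g p ≤ 0 := by
    rcases hp with h | ⟨h, h'⟩
    · have := mul_nonneg ((hf p).1.nonneg_of_pos_right hpq h hfpos)
        (hg0 p (left_mem_Icc.2 hpq.le))
      rw [h]
      linarith
    · simp [h, h']
  have hWq : 0 ≤ f q * g' q - f' q * g q := by
    rcases hq with h | ⟨h, h'⟩
    · have := mul_nonpos_of_nonpos_of_nonneg ((hf q).1.nonpos_of_pos_left hpq h hfpos)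
        (hg0 q (right_mem_Icc.2 hpq.le))
      rw [h]
      linarith
    · simp [h, h']
  dsimp only at hlt
  linarith

theorem pos_or_neg_of_ne_zero_on_Ioo {f : ℝ → ℝ} (hf : Continuous f) {p q : ℝ}
    (hne : ∀ x ∈ Ioo p q, f x ≠ 0) :
    (∀ x ∈ Ioo p q, 0 < f x) ∨ ∀ x ∈ Ioo p q, 0 < -f x := by
  by_contra! h
  obtain ⟨⟨x, hx, hx0⟩, y, hy, hy0⟩ := h
  obtain ⟨z, hz, hz0⟩ := isPreconnected_Ioo.intermediate_value hx hy hf.continuousOn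
    (show (0 : ℝ) ∈ Icc (f x) (f y) from ⟨hx0, by linarith⟩)
  exact hne z hz hz0

/-- Sturm comparison: at either end of `(p, q)`, `f` vanishes or both `f` and `g` satisfy the
Neumann condition. -/
theorem SolvesHill.exists_zero_between {Q R f f' g g' : ℝ → ℝ} (hQR : ∀ x, Q x < R x)
    (hf : SolvesHill Q f f') (hg : SolvesHill R g g') {p q : ℝ} (hpq : p < q)
    (hp : f p = 0 ∨ f' p = 0 ∧ g' p = 0) (hq : f q = 0 ∨ f' q = 0 ∧ g' q = 0)
    (hfne : ∀ x ∈ Ioo p q, f x ≠ 0) : ∃ w ∈ Ioo p q, g w = 0 := by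
  by_contra! hgne
  rcases pos_or_neg_of_ne_zero_on_Ioo hf.continuous hfne with h1 | h1 <;>
    rcases pos_or_neg_of_ne_zero_on_Ioo hg.continuous hgne with h2 | h2
  · exact hf.not_both_pos hQR hg hpq hp hq h1 h2
  · exact hf.not_both_pos hQR hg.neg hpq (by simpa using hp) (by simpa using hq) h1 h2
  · exact hf.neg.not_both_pos hQR hg hpq (by simpa using hp) (by simpa using hq) h1 h2
  · exact hf.neg.not_both_pos hQR hg.neg hpq (by simpa using hp) (by simpa using hq) h1 h2

theorem SolvesHill.ncard_zeros_lt {Q R f f' g g' : ℝ → ℝ} (hQR : ∀ x, Q x < R x)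
    (hf : SolvesHill Q f f') (hg : SolvesHill R g g') {p q : ℝ} (hpq : p < q)
    (hp : f' p = 0 ∧ g' p = 0) (hq : f' q = 0 ∧ g' q = 0)
    (hffin : {x | x ∈ Ioo p q ∧ f x = 0}.Finite)
    (hgfin : {x | x ∈ Ioo p q ∧ g x = 0}.Finite) :
    {x | x ∈ Ioo p q ∧ f x = 0}.ncard < {x | x ∈ Ioo p q ∧ g x = 0}.ncard := by
  set Z := {x | x ∈ Ioo p q ∧ f x = 0} with hZ
  have hstart : ∀ r ∈ insert p Z, r ∈ Ico p q ∧ (f r = 0 ∨ f' r = 0 ∧ g' r = 0) := by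
    rintro r (rfl | hr)
    · exact ⟨left_mem_Ico.2 hpq, Or.inr hp⟩
    · exact ⟨Ioo_subset_Ico_self hr.1, Or.inl hr.2⟩
  have key : ∀ r ∈ insert p Z, ∃ w ∈ Ioo r q, g w = 0 ∧ ∀ x ∈ Ioc r w, f x ≠ 0 := by
    intro r hr
    obtain ⟨hrI, hrb⟩ := hstart r hr
    obtain ⟨s, ⟨hsZ, hrs⟩, hmin⟩ := Set.exists_min_image (insert q Z ∩ Ioi r) id
      ((hffin.insert q).inter_of_left _) ⟨q, mem_insert _ _, hrI.2⟩
    have hsb : s ≤ q ∧ (f s = 0 ∨ f' s = 0 ∧ g' s = 0) := by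
      rcases hsZ with rfl | h
      · exact ⟨le_rfl, Or.inr hq⟩
      · exact ⟨h.1.2.le, Or.inl h.2⟩
    have hfne : ∀ x ∈ Ioo r s, f x ≠ 0 := by
      intro x hx hx0
      have hxZ : x ∈ Z := ⟨⟨hrI.1.trans_lt hx.1, hx.2.trans_le hsb.1⟩, hx0⟩
      exact (hmin x ⟨mem_insert_of_mem _ hxZ, hx.1⟩).not_gt hx.2
    obtain ⟨w, hw, hw0⟩ := hf.exists_zero_between hQR hg hrs hrb hsb.2 hfne
    exact ⟨w, ⟨hw.1, hw.2.trans_le hsb.1⟩, hw0,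
      fun x hx => hfne x ⟨hx.1, hx.2.trans_lt hw.2⟩⟩
  choose! φ hφ using key
  have hpZ : p ∉ Z := fun h => lt_irrefl p h.1.1
  rw [← Nat.add_one_le_iff, ← ncard_insert_of_notMem hpZ hffin]
  have hsep : ∀ r ∈ insert p Z, ∀ s ∈ insert p Z, φ r = φ s → ¬ r < s := by
    intro r hr s hs h hrs
    have hsZ : s ∈ Z := by
      rcases hs with rfl | hs
      · exact absurd hrs (hstart r hr).1.1.not_gt
      · exact hs
    exact (hφ r hr).2.2 s ⟨hrs, h ▸ (hφ s hs).1.1.le⟩ hsZ.2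
  refine ncard_le_ncard_of_injOn φ (fun r hr => ?_) (fun r hr s hs h => ?_) hgfin
  · obtain ⟨hw, hw0, -⟩ := hφ r hr
    exact ⟨⟨(hstart r hr).1.1.trans_lt hw.1, hw.2⟩, hw0⟩
  · exact le_antisymm (not_lt.1 (hsep s hs r hr h.symm)) (not_lt.1 (hsep r hr s hs h))

/-- A function symmetric about `a / 2` and nonzero at `0` and `a / 2` has twice as many zeros
in the period as in the half-period. -/
theorem ncard_zeros_Ico_eq_two_mul {f : ℝ → ℝ} {a : ℝ}
    (hsymm : ∀ x, f (a - x) = f x) (h0 : f 0 ≠ 0) (hb : f (a / 2) ≠ 0)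
    (hfin : {x | x ∈ Ioo 0 (a / 2) ∧ f x = 0}.Finite) :
    {x | x ∈ Ico 0 a ∧ f x = 0}.ncard = 2 * {x | x ∈ Ioo 0 (a / 2) ∧ f x = 0}.ncard := by
  set Z := {x | x ∈ Ioo 0 (a / 2) ∧ f x = 0} with hZ
  have hunion : {x | x ∈ Ico 0 a ∧ f x = 0} = Z ∪ (fun x => a - x) '' Z := by
    ext x
    constructor
    · rintro ⟨⟨hx0, hxa⟩, hfx⟩
      have hx0' : 0 < x := lt_of_le_of_ne hx0 fun h => h0 (h ▸ hfx)
      rcases lt_trichotomy x (a / 2) with h | h | h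
      · exact Or.inl ⟨⟨hx0', h⟩, hfx⟩
      · exact absurd (h ▸ hfx) hb
      · exact Or.inr ⟨a - x, ⟨⟨by linarith, by linarith⟩, by rw [hsymm, hfx]⟩, by ring⟩
    · rintro (⟨⟨h1, h2⟩, hfx⟩ | ⟨y, ⟨⟨h1, h2⟩, hfy⟩, rfl⟩)
      · exact ⟨⟨h1.le, by linarith⟩, hfx⟩
      · exact ⟨⟨by dsimp only; linarith, by dsimp only; linarith⟩, by rw [hsymm, hfy]⟩
  have hdisj : Disjoint Z ((fun x => a - x) '' Z) := by
    rw [Set.disjoint_left]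
    rintro _ hx ⟨y, hy, rfl⟩
    have h1 := hx.1.2
    have h2 := hy.1.2
    dsimp only at h1
    linarith
  rw [hunion, ncard_union_eq hdisj hfin (hfin.image _),
    ncard_image_of_injective _ sub_right_injective]
  ring

theorem IsPeriodicEigenfunction.solvesHill {a lam : ℝ} {V f : ℝ → ℝ}
    (hf : IsPeriodicEigenfunction a V lam f) :
    SolvesHill (fun x => V x + lam) f (deriv f) := by
  obtain ⟨hsm, -, hode, -⟩ := hf
  intro x
  have hd : ContDiff ℝ (⊤ : ℕ∞) (deriv f) := (contDiff_infty_iff_deriv.1 hsm).2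
  refine ⟨(hsm.differentiable (by simp) x).hasDerivAt, ?_⟩
  exact ((hd.differentiable (by simp) x).hasDerivAt).congr_deriv (by linarith [hode x])

theorem exists_abs_add_le_of_periodic {V : ℝ → ℝ} {a : ℝ} (ha : 0 < a) (hV : Continuous V)
    (hVper : ∀ x, V (x + a) = V x) (lam : ℝ) : ∃ K, ∀ x, |V x + lam| ≤ K := by
  have hper : Function.Periodic (fun x => V x + lam) a := fun x => by simp [hVper x]
  obtain ⟨K, hK⟩ := (hper.isBounded_of_continuous ha.ne' (by fun_prop)).exists_norm_le
  exact ⟨K, fun x => hK _ (mem_range_self x)⟩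

theorem IsPeriodicEigenfunction.even_half_period {a lam : ℝ} {V f : ℝ → ℝ} (ha : 0 < a)
    (hV : Continuous V) (hVper : ∀ x, V (x + a) = V x) (hVeven : ∀ x, V (-x) = V x)
    (hf : IsPeriodicEigenfunction a V lam f) (hf0 : deriv f 0 = 0) :
    deriv f (a / 2) = 0 ∧ {x | x ∈ Ioo 0 (a / 2) ∧ f x = 0}.Finite ∧
      {x | x ∈ Ico 0 a ∧ f x = 0}.ncard = 2 * {x | x ∈ Ioo 0 (a / 2) ∧ f x = 0}.ncard := by
  obtain ⟨K, hK⟩ := exists_abs_add_le_of_periodic ha hV hVper lam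
  have hs := hf.solvesHill
  have hVs : ∀ x, V (a - x) = V x := fun x => by
    rw [← hVeven x, ← hVper (-x)]
    congr 1
    ring
  have hfa : f 0 = f a := by simpa using (hf.2.2.2 0).symm
  have hfa' : deriv f a = 0 := by
    have := deriv_comp_add_const f a 0
    rwa [funext hf.2.2.2, zero_add, hf0, eq_comm] at this
  obtain ⟨h1, h2⟩ := hs.eq_of_eq_at hK (hs.comp_const_sub (a := a) fun x => by simp [hVs x])
    (c := 0) (by simpa using hfa) (by simp [hf0, hfa'])
  have hmid : deriv f (a / 2) = 0 := by
    have := congrFun h2 (a / 2)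
    rw [sub_half] at this
    linarith
  have hfin : {x | x ∈ Ioo 0 (a / 2) ∧ f x = 0}.Finite :=
    (hs.finite_zeros hK hf.2.1 0 (a / 2)).subset fun x hx => ⟨Ioo_subset_Icc_self hx.1, hx.2⟩
  exact ⟨hmid, hfin, ncard_zeros_Ico_eq_two_mul (fun x => (congrFun h1 x).symm)
    (fun h => hs.deriv_ne_zero hK hf.2.1 h hf0) (fun h => hs.deriv_ne_zero hK hf.2.1 h hmid)
    hfin⟩

/-- For `V` real-analytic, `a`-periodic and even: if `f`, `g` are periodic eigenfunctions
for eigenvalues `lam < μ`, both with vanishing derivative at `0` (hence both even), and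
`f` has `n` zeros and `g` has `m` zeros in `[0,a)`, then `m ≥ n + 2`. -/
theorem even_eigenfunctions_node_gap (a : ℝ) (ha : 0 < a) (V : ℝ → ℝ)
    (hV : AnalyticOnNhd ℝ V Set.univ) (hVper : ∀ x : ℝ, V (x + a) = V x)
    (hVeven : ∀ x : ℝ, V (-x) = V x) (lam μ : ℝ) (hlt : lam < μ) (f g : ℝ → ℝ)
    (hf : IsPeriodicEigenfunction a V lam f) (hg : IsPeriodicEigenfunction a V μ g)
    (hf0 : deriv f 0 = 0) (hg0 : deriv g 0 = 0) (n m : ℕ)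
    (hn : {x : ℝ | x ∈ Set.Ico 0 a ∧ f x = 0}.ncard = n)
    (hm : {x : ℝ | x ∈ Set.Ico 0 a ∧ g x = 0}.ncard = m) :
    n + 2 ≤ m := by
  have hVc : Continuous V := continuousOn_univ.1 hV.continuousOn
  obtain ⟨hfb, hffin, hfc⟩ := hf.even_half_period ha hVc hVper hVeven hf0
  obtain ⟨hgb, hgfin, hgc⟩ := hg.even_half_period ha hVc hVper hVeven hg0
  have hlt' := hf.solvesHill.ncard_zeros_lt (fun x => by linarith) hg.solvesHill (half_pos ha)
    ⟨hf0, hg0⟩ ⟨hfb, hgb⟩ hffin hgfin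
  omega
end

section
/- Let a > 0 and let V : ℝ → ℝ be real-analytic, a-periodic and even (V(−x) = V(x) for all x). Let λ₁ < λ₂ < λ₃ be real numbers and let f₁, f₂, f₃ be periodic eigenfunctions of L = −d²/dx² − V for λ₁, λ₂, λ₃ respectively, each satisfying f_i(0) = 0 or f_i'(0) = 0 (i.e., each is an even or odd function of x). If n₁, n₂, n₃ denote the numbers of zeros of f₁, f₂, f₃ in [0,a), then n₁ ≤ n₂ ≤ n₃ and n₃ ≥ n₁ + 2. -/
/-- A solution of the eigenvalue equation for `lam`, bundled with its derivative. -/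
structure IsSolution (V : ℝ → ℝ) (lam : ℝ) (f f' : ℝ → ℝ) : Prop where
  hasDerivAt : ∀ x, HasDerivAt f (f' x) x
  hasDerivAt' : ∀ x, HasDerivAt f' (-((V x + lam) * f x)) x

theorem IsPeriodicEigenfunction.isSolution {a lam : ℝ} {V f : ℝ → ℝ}
    (h : IsPeriodicEigenfunction a V lam f) : IsSolution V lam f (deriv f) := by
  have hd : ContDiff ℝ 1 (deriv f) := by
    have h2 : ContDiff ℝ (1 + 1) f := h.1.of_le (by
      rw [one_add_one_eq_two]
      exact WithTop.coe_le_coe.2 le_top)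
    exact (contDiff_succ_iff_deriv.1 h2).2.2
  refine ⟨fun x => (h.1.differentiable (by simp) x).hasDerivAt, fun x => ?_⟩
  have := (hd.differentiable (by simp) x).hasDerivAt
  rwa [eq_neg_of_add_eq_zero_left (h.2.2.1 x)] at this

namespace IsSolution

variable {V f f' g g' : ℝ → ℝ} {lam mu a : ℝ}

theorem continuous (h : IsSolution V lam f f') : Continuous f :=
  continuous_iff_continuousAt.2 fun x => (h.hasDerivAt x).continuousAt

theorem const_mul (h : IsSolution V lam f f') (c : ℝ) :
    IsSolution V lam (fun x => c * f x) (fun x => c * f' x) where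
  hasDerivAt x := (h.hasDerivAt x).const_mul c
  hasDerivAt' x := ((h.hasDerivAt' x).const_mul c).congr_deriv (by ring)

theorem add (h : IsSolution V lam f f') (k : IsSolution V lam g g') :
    IsSolution V lam (fun x => f x + g x) (fun x => f' x + g' x) where
  hasDerivAt x := (h.hasDerivAt x).add (k.hasDerivAt x)
  hasDerivAt' x := ((h.hasDerivAt' x).add (k.hasDerivAt' x)).congr_deriv (by ring)

theorem comp_neg (h : IsSolution V lam f f') (hVeven : ∀ x, V (-x) = V x) :
    IsSolution V lam (fun x => f (-x)) (fun x => -f' (-x)) where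
  hasDerivAt x := ((h.hasDerivAt (-x)).comp x (hasDerivAt_neg x)).congr_deriv (by ring)
  hasDerivAt' x :=
    ((h.hasDerivAt' (-x)).comp x (hasDerivAt_neg x)).neg.congr_deriv (by rw [hVeven]; ring)

/-- A solution with vanishing Cauchy data is zero. -/
theorem eq_zero (h : IsSolution V lam f f') {C : ℝ} (hC : ∀ x, |V x| ≤ C) {x₀ : ℝ}
    (h0 : f x₀ = 0) (h0' : f' x₀ = 0) : f = 0 := by
  set K := 1 + C + |lam|
  have hK : ∀ x, |1 - (V x + lam)| ≤ K := fun x => by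
    have h1 := abs_le.1 (hC x)
    have h2 := neg_abs_le lam
    have h3 := le_abs_self lam
    rw [abs_le]
    constructor <;> simp only [K] <;> linarith
  set E : ℝ → ℝ := fun x => f x ^ 2 + f' x ^ 2
  have hE : ∀ x, HasDerivAt E (2 * f x * f' x * (1 - (V x + lam))) x := fun x =>
    (((h.hasDerivAt x).pow 2).add ((h.hasDerivAt' x).pow 2)).congr_deriv (by push_cast; ring)
  have hEb : ∀ x, |2 * f x * f' x * (1 - (V x + lam))| ≤ K * E x := fun x => by
    rw [abs_mul, mul_comm K]
    refine mul_le_mul ?_ (hK x) (abs_nonneg _) (by positivity)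
    rw [abs_le]
    constructor <;> simp only [E] <;> nlinarith [sq_nonneg (f x + f' x), sq_nonneg (f x - f' x)]
  have hderiv : ∀ c x, HasDerivAt (fun x => E x * Real.exp (c * x))
      ((2 * f x * f' x * (1 - (V x + lam)) + c * E x) * Real.exp (c * x)) x := fun c x =>
    ((hE x).mul (((hasDerivAt_id x).const_mul c).exp)).congr_deriv (by simp; ring)
  have hanti : Antitone fun x => E x * Real.exp (-K * x) := by
    refine antitone_of_deriv_nonpos (fun x => (hderiv _ x).differentiableAt) fun x => ?_
    rw [(hderiv _ x).deriv]
    exact mul_nonpos_of_nonpos_of_nonneg (by linarith [(abs_le.1 (hEb x)).2])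
      (Real.exp_pos _).le
  have hmono : Monotone fun x => E x * Real.exp (K * x) := by
    refine monotone_of_deriv_nonneg (fun x => (hderiv _ x).differentiableAt) fun x => ?_
    rw [(hderiv _ x).deriv]
    exact mul_nonneg (by linarith [(abs_le.1 (hEb x)).1]) (Real.exp_pos _).le
  have hE0 : E x₀ = 0 := by simp [E, h0, h0']
  funext x
  have hEx : E x ≤ 0 := by
    rcases le_total x₀ x with hx | hx
    · have := hanti hx
      simp only [hE0, zero_mul] at this
      exact nonpos_of_mul_nonpos_left this (Real.exp_pos _)
    · have := hmono hx
      simp only [hE0, zero_mul] at this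
      exact nonpos_of_mul_nonpos_left this (Real.exp_pos _)
  have : f x ^ 2 ≤ 0 := by
    simp only [E] at hEx
    nlinarith [sq_nonneg (f' x)]
  simpa using le_antisymm this (sq_nonneg _)

theorem finite_zeros (h : IsSolution V lam f f') {C : ℝ} (hC : ∀ x, |V x| ≤ C) (hf : f ≠ 0)
    {K : Set ℝ} (hK : IsCompact K) : {x | x ∈ K ∧ f x = 0}.Finite := by
  by_contra hinf
  obtain ⟨x, -, hx⟩ := Set.Infinite.exists_accPt_of_subset_isCompact (s := {x | x ∈ K ∧ f x = 0})
    hinf hK fun x hx => hx.1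
  rw [accPt_iff_frequently_nhdsNE] at hx
  have hx0 : f x = 0 := by
    by_contra hne
    have : ∀ᶠ y in nhdsWithin x {x}ᶜ, f y ≠ 0 :=
      (h.continuous.continuousAt.eventually_ne hne).filter_mono nhdsWithin_le_nhds
    exact hx (this.mono fun y hy hy' => hy hy'.2)
  have hx' : f' x = 0 := by
    by_contra hne
    exact hx (((h.hasDerivAt x).eventually_ne hne (c := 0)).mono fun y hy hy' => hy hy'.2)
  exact hf (h.eq_zero hC hx0 hx')

private theorem not_pos_pos (h : IsSolution V lam f f') (k : IsSolution V mu g g')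
    (hlm : lam < mu) {A B : ℝ} (hAB : A < B) (hA : f A = 0 ∨ f' A = 0 ∧ g' A = 0)
    (hB : f B = 0 ∨ f' B = 0 ∧ g' B = 0) (hf : ∀ x ∈ Set.Ioo A B, 0 < f x)
    (hg : ∀ x ∈ Set.Ioo A B, 0 < g x) : False := by
  have hW : ∀ x, HasDerivAt (fun x => f' x * g x - f x * g' x) ((mu - lam) * (f x * g x)) x :=
    fun x => (((h.hasDerivAt' x).mul (k.hasDerivAt x)).sub
      ((h.hasDerivAt x).mul (k.hasDerivAt' x))).congr_deriv (by ring)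
  have hmono : StrictMonoOn (fun x => f' x * g x - f x * g' x) (Set.Icc A B) := by
    refine strictMonoOn_of_deriv_pos (convex_Icc A B)
      (fun x _ => (hW x).continuousAt.continuousWithinAt) fun x hx => ?_
    rw [interior_Icc] at hx
    rw [(hW x).deriv]
    exact mul_pos (sub_pos.2 hlm) (mul_pos (hf x hx) (hg x hx))
  have hlt := hmono (Set.left_mem_Icc.2 hAB.le) (Set.right_mem_Icc.2 hAB.le) hAB
  have nonneg : ∀ x ∈ Set.Icc A B, 0 ≤ g x := by
    have hcl : IsClosed {x | 0 ≤ g x} := isClosed_le continuous_const k.continuous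
    have := hcl.closure_subset_iff.2 (fun x hx => (hg x hx).le : Set.Ioo A B ⊆ {x | 0 ≤ g x})
    rwa [closure_Ioo hAB.ne] at this
  have hWA : 0 ≤ f' A * g A - f A * g' A := by
    rcases hA with hA | hA
    · have hd : 0 ≤ f' A := by
        refine ge_of_tendsto ((hasDerivWithinAt_iff_tendsto_slope' (s := Set.Ioi A) (by simp)).1
          (h.hasDerivAt A).hasDerivWithinAt) ?_
        filter_upwards [Ioo_mem_nhdsGT hAB] with y hy
        rw [slope_def_field, hA, sub_zero]
        exact div_nonneg (hf y hy).le (sub_nonneg.2 hy.1.le)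
      have := mul_nonneg hd (nonneg A (Set.left_mem_Icc.2 hAB.le))
      simpa [hA] using this
    · simp [hA.1, hA.2]
  have hWB : f' B * g B - f B * g' B ≤ 0 := by
    rcases hB with hB | hB
    · have hd : f' B ≤ 0 := by
        refine le_of_tendsto ((hasDerivWithinAt_iff_tendsto_slope' (s := Set.Iio B) (by simp)).1
          (h.hasDerivAt B).hasDerivWithinAt) ?_
        filter_upwards [Ioo_mem_nhdsLT hAB] with y hy
        rw [slope_def_field, hB, sub_zero]
        exact div_nonpos_of_nonneg_of_nonpos (hf y hy).le (sub_nonpos.2 hy.2.le)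
      have := mul_nonpos_of_nonpos_of_nonneg hd (nonneg B (Set.right_mem_Icc.2 hAB.le))
      simpa [hB] using this
    · simp [hB.1, hB.2]
  linarith

private theorem exists_sign_mul_pos (hf : Continuous f) {A B : ℝ}
    (h0 : ∀ x ∈ Set.Ioo A B, f x ≠ 0) : ∃ c : ℝ, ∀ x ∈ Set.Ioo A B, 0 < c * f x := by
  by_contra! hcon
  obtain ⟨x, hx, hx'⟩ := hcon 1
  obtain ⟨y, hy, hy'⟩ := hcon (-1)
  obtain ⟨z, hz, hz'⟩ := isPreconnected_Ioo.intermediate_value hx hy hf.continuousOn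
    (show (0 : ℝ) ∈ Set.Icc (f x) (f y) from ⟨by linarith, by linarith⟩)
  exact h0 z hz hz'

/-- Sturm comparison: `g` vanishes inside a nodal interval of `f`, where at each end either `f`
vanishes or both `f` and `g` have a critical point. -/
theorem exists_zero_mem_Ioo (h : IsSolution V lam f f') (k : IsSolution V mu g g')
    (hlm : lam < mu) {A B : ℝ} (hAB : A < B) (hA : f A = 0 ∨ f' A = 0 ∧ g' A = 0)
    (hB : f B = 0 ∨ f' B = 0 ∧ g' B = 0) (hf : ∀ x ∈ Set.Ioo A B, f x ≠ 0) :
    ∃ x ∈ Set.Ioo A B, g x = 0 := by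
  by_contra! hg
  obtain ⟨c, hc⟩ := exists_sign_mul_pos h.continuous hf
  obtain ⟨d, hd⟩ := exists_sign_mul_pos k.continuous hg
  refine (h.const_mul c).not_pos_pos (k.const_mul d) hlm hAB (hA.imp ?_ ?_) (hB.imp ?_ ?_) hc hd
  all_goals simp +contextual

theorem ncard_le_ncard_zeros_add_one (h : IsSolution V lam f f') (k : IsSolution V mu g g')
    (hlm : lam < mu) {A B : ℝ} {S : Set ℝ} (hS : S.Finite)
    (hT : {x | x ∈ Set.Ioo A B ∧ g x = 0}.Finite) (hSAB : S ⊆ Set.Icc A B)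
    (hfS : {x | x ∈ Set.Ioo A B ∧ f x = 0} ⊆ S)
    (hbd : ∀ x ∈ S, f x = 0 ∨ f' x = 0 ∧ g' x = 0) :
    S.ncard ≤ {x | x ∈ Set.Ioo A B ∧ g x = 0}.ncard + 1 := by
  rw [Set.ncard_eq_toFinset_card _ hS, Set.ncard_eq_toFinset_card _ hT]
  refine Finset.card_le_of_interleaved fun x hx y hy hxy hgap => ?_
  simp only [Set.Finite.mem_toFinset] at hx hy hgap
  have hsub : Set.Ioo x y ⊆ Set.Ioo A B := fun z hz =>
    ⟨(hSAB hx).1.trans_lt hz.1, hz.2.trans_le (hSAB hy).2⟩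
  obtain ⟨z, hz, hz0⟩ := h.exists_zero_mem_Ioo k hlm hxy (hbd x hx) (hbd y hy)
    fun z hz hz0 => hgap z (hfS ⟨hsub hz, hz0⟩) hz
  exact ⟨z, by simpa using ⟨hsub hz, hz0⟩, hz.1, hz.2⟩

theorem even_of_deriv_eq_zero (h : IsSolution V lam f f') {C : ℝ} (hC : ∀ x, |V x| ≤ C)
    (hVeven : ∀ x, V (-x) = V x) (h0 : f' 0 = 0) (x : ℝ) : f (-x) = f x := by
  have := congrFun ((h.add ((h.comp_neg hVeven).const_mul (-1))).eq_zero hC (x₀ := 0)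
    (by simp) (by simp [h0])) x
  simp only [Pi.zero_apply] at this
  linarith

theorem odd_of_eq_zero (h : IsSolution V lam f f') {C : ℝ} (hC : ∀ x, |V x| ≤ C)
    (hVeven : ∀ x, V (-x) = V x) (h0 : f 0 = 0) (x : ℝ) : f (-x) = -f x := by
  have := congrFun ((h.add (h.comp_neg hVeven)).eq_zero hC (x₀ := 0)
    (by simp [h0]) (by simp)) x
  simp only [Pi.zero_apply] at this
  linarith

/-- An even periodic function has a critical point at the half period. -/
theorem deriv_half_period (h : IsSolution V lam f f') (hsymm : ∀ x, f (a - x) = f x) :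
    f' (a / 2) = 0 := by
  have h1 : HasDerivAt (fun x => f (a - x)) (-f' (a / 2)) (a / 2) := by
    have h2 : HasDerivAt f (f' (a / 2)) (a - a / 2) := by
      rw [sub_half]; exact h.hasDerivAt _
    exact (h2.comp (a / 2) ((hasDerivAt_id _).const_sub a)).congr_deriv (by ring)
  rw [funext hsymm] at h1
  linarith [h1.unique (h.hasDerivAt (a / 2))]

end IsSolution

section Counting

variable {f : ℝ → ℝ} {a : ℝ}

/-- The zeros in the open half period and their reflections. -/
theorem ncard_union_reflection {S : Set ℝ} (hS : S.Finite) (hSa : S ⊆ Set.Ioo 0 (a / 2)) :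
    (S ∪ (fun x => a - x) '' S).ncard = 2 * S.ncard := by
  rw [Set.ncard_union_eq _ hS (hS.image _), Set.ncard_image_of_injective _ sub_right_injective,
    two_mul]
  rw [Set.disjoint_left]
  rintro x hx ⟨y, hy, rfl⟩
  have h1 := (hSa hx).2
  have h2 := (hSa hy).2
  linarith

theorem zeros_diff_fixed_eq (hsymm : ∀ x, f x = 0 → f (a - x) = 0) :
    {x | x ∈ Set.Ico 0 a ∧ f x = 0} \ {0, a / 2} =
      {x | x ∈ Set.Ioo 0 (a / 2) ∧ f x = 0} ∪
        (fun x => a - x) '' {x | x ∈ Set.Ioo 0 (a / 2) ∧ f x = 0} := by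
  ext x
  simp only [Set.mem_sdiff, Set.mem_ofPred_eq, Set.mem_Ico, Set.mem_insert_iff,
    Set.mem_singleton_iff, not_or, Set.mem_union, Set.mem_image, Set.mem_Ioo]
  constructor
  · rintro ⟨⟨⟨h0, h1⟩, hx⟩, h2, h3⟩
    have h0' := lt_of_le_of_ne h0 (Ne.symm h2)
    rcases lt_or_gt_of_ne h3 with h | h
    · exact Or.inl ⟨⟨h0', h⟩, hx⟩
    · exact Or.inr ⟨a - x, ⟨⟨by linarith, by linarith⟩, hsymm x hx⟩, by ring⟩
  · rintro (⟨⟨h0, h1⟩, hx⟩ | ⟨y, ⟨⟨h0, h1⟩, hy⟩, rfl⟩)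
    · exact ⟨⟨⟨h0.le, by linarith⟩, hx⟩, h0.ne', h1.ne⟩
    · exact ⟨⟨⟨by linarith, by linarith⟩, hsymm y hy⟩, by linarith, fun h => by linarith⟩

theorem ncard_zeros_of_ne (hsymm : ∀ x, f x = 0 → f (a - x) = 0) (h0 : f 0 ≠ 0)
    (h1 : f (a / 2) ≠ 0) (hfin : {x | x ∈ Set.Ioo 0 (a / 2) ∧ f x = 0}.Finite) :
    {x | x ∈ Set.Ico 0 a ∧ f x = 0}.ncard =
      2 * {x | x ∈ Set.Ioo 0 (a / 2) ∧ f x = 0}.ncard := by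
  rw [← ncard_union_reflection hfin fun x hx => hx.1, ← zeros_diff_fixed_eq hsymm,
    sdiff_eq_left.2]
  rw [Set.disjoint_left]
  rintro x ⟨-, hx⟩ (rfl | rfl)
  exacts [h0 hx, h1 hx]

theorem ncard_zeros_of_eq (ha : 0 < a) (hsymm : ∀ x, f x = 0 → f (a - x) = 0) (h0 : f 0 = 0)
    (h1 : f (a / 2) = 0) (hfin : {x | x ∈ Set.Ioo 0 (a / 2) ∧ f x = 0}.Finite)
    (hfin' : {x | x ∈ Set.Ico 0 a ∧ f x = 0}.Finite) :
    {x | x ∈ Set.Ico 0 a ∧ f x = 0}.ncard =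
      2 * {x | x ∈ Set.Ioo 0 (a / 2) ∧ f x = 0}.ncard + 2 := by
  rw [← ncard_union_reflection hfin fun x hx => hx.1, ← zeros_diff_fixed_eq hsymm,
    ← Set.ncard_pair (show (0 : ℝ) ≠ a / 2 by linarith)]
  refine (Set.ncard_sdiff_add_ncard_of_subset ?_ hfin').symm
  rintro x (rfl | rfl)
  exacts [⟨⟨le_rfl, ha⟩, h0⟩, ⟨⟨by linarith, by linarith⟩, h1⟩]

end Counting

namespace IsSolution

variable {V f f' g g' : ℝ → ℝ} {lam mu a : ℝ}

theorem finite_zeros_Ioo (h : IsSolution V lam f f') {C : ℝ} (hC : ∀ x, |V x| ≤ C) (hf : f ≠ 0)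
    (A B : ℝ) : {x | x ∈ Set.Ioo A B ∧ f x = 0}.Finite :=
  (h.finite_zeros hC hf (isCompact_Icc (a := A) (b := B))).subset fun _ hx =>
    ⟨Set.Ioo_subset_Icc_self hx.1, hx.2⟩

/-- Behaviour at the half period and node count of an even or odd periodic solution. -/
theorem even_or_odd_data (h : IsSolution V lam f f') (ha : 0 < a) {C : ℝ}
    (hC : ∀ x, |V x| ≤ C) (hVeven : ∀ x, V (-x) = V x) (hf : f ≠ 0)
    (hper : ∀ x, f (x + a) = f x) (hic : f 0 = 0 ∨ f' 0 = 0) :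
    (f 0 = 0 ∧ f (a / 2) = 0 ∧ {x | x ∈ Set.Ico 0 a ∧ f x = 0}.ncard =
      2 * {x | x ∈ Set.Ioo 0 (a / 2) ∧ f x = 0}.ncard + 2) ∨
    (f 0 ≠ 0 ∧ f' 0 = 0 ∧ f' (a / 2) = 0 ∧ {x | x ∈ Set.Ico 0 a ∧ f x = 0}.ncard =
      2 * {x | x ∈ Set.Ioo 0 (a / 2) ∧ f x = 0}.ncard) := by
  have hrefl : ∀ x, f (a - x) = f (-x) := fun x => by rw [← hper (-x)]; ring_nf
  have hfin := h.finite_zeros_Ioo hC hf 0 (a / 2)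
  by_cases h0 : f 0 = 0
  · have hodd := h.odd_of_eq_zero hC hVeven h0
    have hh : f (a / 2) = 0 := by
      have := hrefl (a / 2)
      rw [hodd, sub_half] at this
      linarith
    refine Or.inl ⟨h0, hh, ncard_zeros_of_eq ha (fun x hx => ?_) h0 hh hfin ?_⟩
    · rw [hrefl, hodd, hx, neg_zero]
    · exact (h.finite_zeros hC hf (isCompact_Icc (a := 0) (b := a))).subset fun _ hx =>
        ⟨Set.Ico_subset_Icc_self hx.1, hx.2⟩
  · have h0' := hic.resolve_left h0
    have hsymm : ∀ x, f (a - x) = f x := fun x => by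
      rw [hrefl, h.even_of_deriv_eq_zero hC hVeven h0']
    have hh := h.deriv_half_period hsymm
    exact Or.inr ⟨h0, h0', hh, ncard_zeros_of_ne (fun x hx => by rw [hsymm, hx]) h0
      (fun h1 => hf (h.eq_zero hC h1 hh)) hfin⟩

/-- Node counts grow with the eigenvalue, by at least two within a parity class. -/
theorem ncard_zeros_comparison (h : IsSolution V lam f f') (k : IsSolution V mu g g')
    (ha : 0 < a) (hVc : Continuous V) (hVper : ∀ x, V (x + a) = V x)
    (hVeven : ∀ x, V (-x) = V x) (hlm : lam < mu) (hf : f ≠ 0) (hg : g ≠ 0)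
    (hfper : ∀ x, f (x + a) = f x) (hgper : ∀ x, g (x + a) = g x)
    (hfic : f 0 = 0 ∨ f' 0 = 0) (hgic : g 0 = 0 ∨ g' 0 = 0) :
    {x | x ∈ Set.Ico 0 a ∧ f x = 0}.ncard ≤ {x | x ∈ Set.Ico 0 a ∧ g x = 0}.ncard ∧
    ((f 0 = 0 ↔ g 0 = 0) → {x | x ∈ Set.Ico 0 a ∧ f x = 0}.ncard + 2 ≤
      {x | x ∈ Set.Ico 0 a ∧ g x = 0}.ncard) := by
  obtain ⟨C, hC⟩ : ∃ C, ∀ x, |V x| ≤ C := by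
    obtain ⟨C, hC⟩ := (Function.Periodic.compact_of_continuous hVper ha.ne' hVc).isBounded
      |>.exists_norm_le
    exact ⟨C, fun x => hC _ ⟨x, rfl⟩⟩
  have hS := h.finite_zeros_Ioo hC hf 0 (a / 2)
  have hT := k.finite_zeros_Ioo hC hg 0 (a / 2)
  have weak := h.ncard_le_ncard_zeros_add_one k hlm hS hT
    (fun x hx => Set.Ioo_subset_Icc_self hx.1) subset_rfl fun x hx => Or.inl hx.2
  have strong (b0 : f 0 = 0 ∨ f' 0 = 0 ∧ g' 0 = 0)
      (b1 : f (a / 2) = 0 ∨ f' (a / 2) = 0 ∧ g' (a / 2) = 0) :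
      {x | x ∈ Set.Ioo 0 (a / 2) ∧ f x = 0}.ncard + 2 ≤
        {x | x ∈ Set.Ioo 0 (a / 2) ∧ g x = 0}.ncard + 1 := by
    have hpair : ({0, a / 2} : Set ℝ).ncard = 2 := Set.ncard_pair (by linarith)
    have hdisj : Disjoint {x | x ∈ Set.Ioo 0 (a / 2) ∧ f x = 0} {0, a / 2} := by
      rw [Set.disjoint_left]
      rintro x ⟨hx, -⟩ (rfl | rfl)
      exacts [lt_irrefl _ hx.1, lt_irrefl _ hx.2]
    rw [← hpair, ← Set.ncard_union_eq hdisj hS (Set.toFinite _)]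
    refine h.ncard_le_ncard_zeros_add_one k hlm (hS.union (Set.toFinite _)) hT ?_
      Set.subset_union_left ?_
    · rintro x (hx | rfl | rfl)
      exacts [Set.Ioo_subset_Icc_self hx.1, ⟨le_rfl, by linarith⟩, ⟨by linarith, le_rfl⟩]
    · rintro x (hx | rfl | rfl)
      exacts [Or.inl hx.2, b0, b1]
  rcases h.even_or_odd_data ha hC hVeven hf hfper hfic with ⟨f0, f1, fn⟩ | ⟨f0, f0', f1, fn⟩ <;>
    rcases k.even_or_odd_data ha hC hVeven hg hgper hgic with ⟨g0, g1, gn⟩ | ⟨g0, g0', g1, gn⟩ <;>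
    rw [fn, gn]
  · have := strong (Or.inl f0) (Or.inl f1)
    omega
  · have := strong (Or.inl f0) (Or.inl f1)
    exact ⟨by omega, fun hiff => absurd (hiff.1 f0) g0⟩
  · exact ⟨by omega, fun hiff => absurd (hiff.2 g0) f0⟩
  · have := strong (Or.inr ⟨f0', g0'⟩) (Or.inr ⟨f1, g1⟩)
    omega

end IsSolution

/-- For `V` real-analytic, `a`-periodic and even: if `f₁, f₂, f₃` are periodic
eigenfunctions for eigenvalues `λ₁ < λ₂ < λ₃`, each either even or odd (i.e. each
satisfies `fᵢ 0 = 0` or `fᵢ' 0 = 0`), with `n₁, n₂, n₃` zeros in `[0,a)` respectively,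
then `n₁ ≤ n₂ ≤ n₃` and `n₃ ≥ n₁ + 2`. -/
theorem three_eigenfunctions_node_gap (a : ℝ) (ha : 0 < a) (V : ℝ → ℝ)
    (hV : AnalyticOnNhd ℝ V Set.univ) (hVper : ∀ x : ℝ, V (x + a) = V x)
    (hVeven : ∀ x : ℝ, V (-x) = V x) (lam₁ lam₂ lam₃ : ℝ)
    (h12 : lam₁ < lam₂) (h23 : lam₂ < lam₃) (f₁ f₂ f₃ : ℝ → ℝ)
    (hf₁ : IsPeriodicEigenfunction a V lam₁ f₁)
    (hf₂ : IsPeriodicEigenfunction a V lam₂ f₂)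
    (hf₃ : IsPeriodicEigenfunction a V lam₃ f₃)
    (hic₁ : f₁ 0 = 0 ∨ deriv f₁ 0 = 0) (hic₂ : f₂ 0 = 0 ∨ deriv f₂ 0 = 0)
    (hic₃ : f₃ 0 = 0 ∨ deriv f₃ 0 = 0) (n₁ n₂ n₃ : ℕ)
    (hn₁ : {x : ℝ | x ∈ Set.Ico 0 a ∧ f₁ x = 0}.ncard = n₁)
    (hn₂ : {x : ℝ | x ∈ Set.Ico 0 a ∧ f₂ x = 0}.ncard = n₂)
    (hn₃ : {x : ℝ | x ∈ Set.Ico 0 a ∧ f₃ x = 0}.ncard = n₃) :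
    n₁ ≤ n₂ ∧ n₂ ≤ n₃ ∧ n₁ + 2 ≤ n₃ := by
  have h₁ := hf₁.isSolution
  have h₂ := hf₂.isSolution
  have h₃ := hf₃.isSolution
  have hVc : Continuous V := continuous_iff_continuousAt.2 fun x => (hV x trivial).continuousAt
  have e12 := h₁.ncard_zeros_comparison h₂ ha hVc hVper hVeven h12 hf₁.2.1 hf₂.2.1
    hf₁.2.2.2 hf₂.2.2.2 hic₁ hic₂
  have e23 := h₂.ncard_zeros_comparison h₃ ha hVc hVper hVeven h23 hf₂.2.1 hf₃.2.1
    hf₂.2.2.2 hf₃.2.2.2 hic₂ hic₃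
  have e13 := h₁.ncard_zeros_comparison h₃ ha hVc hVper hVeven (h12.trans h23) hf₁.2.1 hf₃.2.1
    hf₁.2.2.2 hf₃.2.2.2 hic₁ hic₃
  rw [hn₁, hn₂] at e12
  rw [hn₂, hn₃] at e23
  rw [hn₁, hn₃] at e13
  refine ⟨e12.1, e23.1, ?_⟩
  by_cases p₁ : f₁ 0 = 0 <;> by_cases p₂ : f₂ 0 = 0 <;> by_cases p₃ : f₃ 0 = 0 <;>
    simp only [p₁, p₂, p₃, true_iff, iff_true, forall_const] at e12 e23 e13 <;> omega
end

section
/- Let a > 0 and let V : ℝ → ℝ be real-analytic and a-periodic. Then every periodic eigenfunction f of L = −d²/dx² − V (for any eigenvalue λ) has a finite, even number of zeros in the half-open interval [0,a). -/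
/-- A continuous function with only simple zeros changes sign across an interval as many times
as it has zeros in it. -/
lemma neg_one_pow_card_mul_pos_of_simple_zeros {p q : ℝ} (hpq : p < q) (S : Finset ℝ) :
    ∀ f : ℝ → ℝ, Continuous f → (∀ x ∈ Set.Icc p q, f x = 0 ↔ x ∈ S) →
      (∀ z ∈ S, z ∈ Set.Ioo p q) → (∀ z ∈ S, ∃ c, c ≠ 0 ∧ HasDerivAt f c z) →
      0 < (-1) ^ S.card * (f p * f q) := by
  induction S using Finset.induction_on with
  | empty =>
    intro f hf h0 _ _
    have hne : ∀ x ∈ Set.Icc p q, f x ≠ 0 := fun x hx h => by simpa using (h0 x hx).1 h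
    by_contra! hle
    simp only [Finset.card_empty, pow_zero, one_mul] at hle
    have hmem : (0 : ℝ) ∈ Set.uIcc (f p) (f q) := by
      rw [Set.mem_uIcc]
      rcases mul_nonpos_iff.1 hle with h | h
      · exact Or.inr ⟨h.2, h.1⟩
      · exact Or.inl h
    obtain ⟨x, hx, hfx⟩ := intermediate_value_uIcc hf.continuousOn hmem
    rw [Set.uIcc_of_le hpq.le] at hx
    exact hne x hx hfx
  | insert z S hz ih =>
    intro f hf h0 hS hd
    have hzpq := hS z (Finset.mem_insert_self z S)
    have hfz : f z = 0 :=
      (h0 z (Set.Ioo_subset_Icc_self hzpq)).2 (Finset.mem_insert_self z S)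
    obtain ⟨c, hc, hfc⟩ := hd z (Finset.mem_insert_self z S)
    have hgz : dslope f z z = c := by rw [dslope_same, hfc.deriv]
    have hfg : ∀ x, f x = (x - z) * dslope f z x := fun x => by
      have := sub_smul_dslope f z x
      rw [hfz, sub_zero, smul_eq_mul] at this
      exact this.symm
    have hg : Continuous (dslope f z) := by
      rw [continuous_iff_continuousAt]
      intro x
      rcases eq_or_ne x z with rfl | hx
      · exact continuousAt_dslope_same.2 hfc.differentiableAt
      · exact (continuousAt_dslope_of_ne hx).2 hf.continuousAt
    have key := ih (dslope f z) hg ?_ (fun w hw => hS w (Finset.mem_insert_of_mem hw)) ?_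
    · rw [Finset.card_insert_of_notMem hz, hfg p, hfg q, pow_succ]
      have h1 : 0 < (z - p) * (q - z) := mul_pos (sub_pos.2 hzpq.1) (sub_pos.2 hzpq.2)
      have h2 := mul_pos h1 key
      linarith
    · intro x hx
      rcases eq_or_ne x z with rfl | hxz
      · rw [hgz]; exact iff_of_false hc hz
      · have := h0 x hx
        rw [hfg x, mul_eq_zero, or_iff_right (sub_ne_zero.2 hxz), Finset.mem_insert,
          or_iff_right hxz] at this
        exact this
    · intro w hw
      have hwz : w ≠ z := fun h => hz (h ▸ hw)
      obtain ⟨d, hd0, hfd⟩ := hd w (Finset.mem_insert_of_mem hw)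
      have hfw : f w = 0 := (h0 w (Set.Ioo_subset_Icc_self
        (hS w (Finset.mem_insert_of_mem hw)))).2 (Finset.mem_insert_of_mem hw)
      have hwz' : w - z ≠ 0 := sub_ne_zero.2 hwz
      refine ⟨d / (w - z), div_ne_zero hd0 hwz', ?_⟩
      have hq := hfd.div ((hasDerivAt_id w).sub_const z) hwz'
      have heq : dslope f z =ᶠ[nhds w] fun x => f x / (x - z) := by
        filter_upwards [isOpen_ne.mem_nhds hwz] with x hx
        rw [hfg x, mul_div_cancel_left₀ _ (sub_ne_zero.2 hx)]
      refine (hq.congr_of_eventuallyEq heq).congr_deriv ?_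
      simp only [id, hfw, zero_mul, sub_zero]
      field_simp

/-- A solution of `f'' + W f = 0` with bounded `W` and vanishing Cauchy data is zero. -/
lemma eq_zero_of_deriv_deriv_add_mul_eq_zero {W f : ℝ → ℝ} {M : ℝ} (hM : ∀ x, |W x| ≤ M)
    (hf : Differentiable ℝ f) (hf' : Differentiable ℝ (deriv f))
    (hode : ∀ x, deriv (deriv f) x + W x * f x = 0) {x₀ : ℝ} (h0 : f x₀ = 0)
    (h1 : deriv f x₀ = 0) : f = 0 := by
  have hlip : ∀ t : ℝ, LipschitzOnWith (max 1 M.toNNReal)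
      (fun y : ℝ × ℝ => (y.2, -(W t * y.1))) Set.univ := by
    intro t
    refine LipschitzOnWith.of_dist_le_mul fun y _ z _ => ?_
    have hM0 : 0 ≤ M := (abs_nonneg _).trans (hM t)
    simp only [Prod.dist_eq, Real.dist_eq, NNReal.coe_max, NNReal.coe_one,
      Real.coe_toNNReal M hM0]
    refine max_le ?_ ?_
    · calc |y.2 - z.2| = 1 * |y.2 - z.2| := (one_mul _).symm
        _ ≤ _ := mul_le_mul (le_max_left _ _) (le_max_right _ _) (abs_nonneg _) (by positivity)
    · calc |-(W t * y.1) - -(W t * z.1)| = |W t| * |y.1 - z.1| := by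
            rw [← abs_mul, ← abs_neg]; ring_nf
        _ ≤ _ := mul_le_mul ((hM t).trans (le_max_right _ _)) (le_max_left _ _)
            (abs_nonneg _) (by positivity)
  have key := ODE_solution_unique_univ (t₀ := x₀) (f := fun t => (f t, deriv f t))
    (g := fun _ => ((0 : ℝ), (0 : ℝ))) hlip
    (fun t => ⟨?_, Set.mem_univ _⟩) (fun t => ⟨?_, Set.mem_univ _⟩) (by simp [h0, h1])
  · funext t
    exact congrArg Prod.fst (congrFun key t)
  · refine ((hf t).hasDerivAt.prodMk (hf' t).hasDerivAt).congr_deriv ?_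
    rw [eq_neg_of_add_eq_zero_left (hode t)]
  · exact (hasDerivAt_const t ((0 : ℝ), (0 : ℝ))).congr_deriv (by ext <;> simp)


/-- Every periodic eigenfunction of `L = -d²/dx² - V` (for `V` real-analytic and
`a`-periodic) has a finite, even number of zeros in `[0,a)`. -/
theorem periodic_eigenfunction_even_node_count (a : ℝ) (ha : 0 < a) (V : ℝ → ℝ)
    (hV : AnalyticOnNhd ℝ V Set.univ) (hVper : ∀ x : ℝ, V (x + a) = V x) (lam : ℝ)
    (f : ℝ → ℝ) (hf : IsPeriodicEigenfunction a V lam f) :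
    {x : ℝ | x ∈ Set.Ico 0 a ∧ f x = 0}.Finite ∧
      Even {x : ℝ | x ∈ Set.Ico 0 a ∧ f x = 0}.ncard := by
  obtain ⟨hsmooth, hne, hode, hper⟩ := hf
  have hf : Differentiable ℝ f := hsmooth.differentiable (by simp)
  have hf' : Differentiable ℝ (deriv f) :=
    ((contDiff_infty_iff_deriv.1 hsmooth).2).differentiable (by simp)
  have hVc : Continuous V := continuousOn_univ.1 hV.continuousOn
  obtain ⟨M, hM⟩ : ∃ M, ∀ x, |V x + lam| ≤ M := by
    have hWper : Function.Periodic (fun x => V x + lam) a := fun x => by simp [hVper x]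
    obtain ⟨M, hM⟩ := (hWper.isBounded_of_continuous ha.ne' (by fun_prop)).exists_norm_le
    exact ⟨M, fun x => hM _ (Set.mem_range_self x)⟩
  have hsimple : ∀ x, f x = 0 → deriv f x ≠ 0 := fun x h0 h1 =>
    hne (eq_zero_of_deriv_deriv_add_mul_eq_zero hM hf hf' hode h0 h1)
  have hiso : ∀ x, ∀ᶠ y in nhdsWithin x {x}ᶜ, f y ≠ 0 := by
    intro x
    by_cases hx : f x = 0
    · exact (hf x).hasDerivAt.eventually_ne (hsimple x hx)
    · exact ((hf x).continuousAt.eventually_ne hx).filter_mono nhdsWithin_le_nhds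
  have hfin : {x : ℝ | x ∈ Set.Ico 0 a ∧ f x = 0}.Finite := by
    by_contra hinf
    obtain ⟨x, -, hx⟩ := Set.Infinite.exists_accPt_of_subset_isCompact hinf
      (isCompact_Icc (a := 0) (b := a)) fun x hx => Set.Ico_subset_Icc_self hx.1
    rw [accPt_iff_frequently_nhdsNE] at hx
    obtain ⟨y, hy, hy0⟩ := (hx.and_eventually (hiso x)).exists
    exact hy0 hy.2
  refine ⟨hfin, ?_⟩
  obtain ⟨ε, hε, hball⟩ := Metric.mem_nhdsWithin_iff.1 (hiso 0)
  have hleft : ∀ t, -ε < t → t < 0 → f t ≠ 0 := fun t h1 h2 =>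
    hball ⟨by rw [Metric.mem_ball, Real.dist_eq, sub_zero, abs_lt]; constructor <;> linarith,
      h2.ne⟩
  obtain ⟨δ, hδ0, hδ⟩ := exists_between (lt_min hε ha)
  rw [lt_min_iff] at hδ
  have hright : ∀ t, a - ε < t → t < a → f t ≠ 0 := fun t h1 h2 => by
    have := hper (t - a)
    rw [sub_add_cancel] at this
    rw [this]
    exact hleft _ (by linarith) (by linarith)
  have hkey := neg_one_pow_card_mul_pos_of_simple_zeros (p := -δ) (q := a - δ) (by linarith)
    hfin.toFinset f hf.continuous ?_ ?_ ?_
  · have hend : f (a - δ) = f (-δ) := by rw [← hper (-δ)]; ring_nf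
    rw [Set.ncard_eq_toFinset_card _ hfin, ← Nat.not_odd_iff_even]
    intro hodd
    rw [hodd.neg_one_pow, hend] at hkey
    nlinarith [mul_self_nonneg (f (-δ))]
  · intro x hx
    rw [Set.Finite.mem_toFinset]
    refine ⟨fun h => ⟨⟨?_, by linarith [hx.2]⟩, h⟩, fun h => h.2⟩
    by_contra! hlt
    exact hleft x (by linarith [hx.1]) hlt h
  · intro z hz
    rw [Set.Finite.mem_toFinset] at hz
    refine ⟨by linarith [hz.1.1], ?_⟩
    by_contra! hlt
    exact hright z (by linarith) hz.1.2 hz.2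
  · intro z hz
    rw [Set.Finite.mem_toFinset] at hz
    exact ⟨_, hsimple z hz.2, (hf z).hasDerivAt⟩
end
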